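/- Fix a squarefree integer d ∉ {0,1} and a square root s_d ∈ ℂ of d; for each fundamental discriminant Δ fix a square root s_Δ ∈ ℂ and set K_Δ := ℚ(s_Δ) ⊆ ℂ and M_Δ := ℚ(s_Δ, s_d) ⊆ ℂ. For every real γ > 0 there exists C > 0, depending only on d and γ, such that for all real B ≥ 2: ∑_{Δ fundamental, Δ ≠ discr(ℚ(s_d)), |Δ| ≤ B^γ} (h_{M_Δ}·R_{M_Δ})^{3/4} · (1 + κ_{M_Δ}) / |Δ|^{3/2} ≤ C · B^{γ/4} · (log B)^{3/4}. -/

import Mathlib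

/-!
Statement 17: the sum of the error terms over quadratic fields of bounded discriminant
(Lemma `lem:errsumxd`).
-/

open NumberField

/-- `Δ` is a fundamental discriminant. -/
def IsFundamentalDiscriminant (Δ : ℤ) : Prop :=
  Δ ≠ 1 ∧ ((Δ % 4 = 1 ∧ Squarefree Δ) ∨
    ∃ m : ℤ, Δ = 4 * m ∧ Squarefree m ∧ (m % 4 = 2 ∨ m % 4 = 3))

/-- The discriminant of `ℚ(√d)` for a squarefree integer `d ∉ {0,1}`. -/
def DL (d : ℤ) : ℤ := if d % 4 = 1 then d else 4 * d

/-- The residue `κ_M = 2^{r_M}·(2π)^{s_M}·h_M·R_M/(w_M·√|Δ_M|)`. -/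
noncomputable def kappa (M : Type*) [Field M] [NumberField M] : ℝ :=
  2 ^ (InfinitePlace.nrRealPlaces M) * (2 * Real.pi) ^ (InfinitePlace.nrComplexPlaces M) *
    (classNumber M) * Units.regulator M /
    ((Units.torsionOrder M : ℕ) * Real.sqrt |(discr M : ℝ)|)

section

lemma abel_bound_aux (f w : ℕ → ℝ) (u v : ℕ) (h : u ≤ v) :
    ∑ i ∈ Finset.Ico u v, w i * f i = w v * ∑ i ∈ Finset.Ico u v, f i +
      ∑ i ∈ Finset.Ico u v, (w i - w (i+1)) * ∑ j ∈ Finset.Ico u (i+1), f j := by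
  induction v, h using Nat.le_induction with
  | base => simp
  | succ n hn ih =>
    rw [Finset.sum_Ico_succ_top hn, Finset.sum_Ico_succ_top hn, Finset.sum_Ico_succ_top hn, ih,
      Finset.sum_Ico_succ_top hn]
    ring

lemma abel_bound (f w : ℕ → ℝ) (Q : ℝ) (u v : ℕ) 
    (hw : ∀ i, u ≤ i → w (i+1) ≤ w i) (hw0 : ∀ i, u ≤ i → 0 ≤ w i) 
    (hQ : ∀ v, |∑ i ∈ Finset.Ico u v, f i| ≤ Q) :
    |∑ i ∈ Finset.Ico u v, w i * f i| ≤ Q * w u := by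
  have hQ0 : 0 ≤ Q := le_trans (abs_nonneg _) (hQ u)
  rcases le_total u v with h | h
  · rw [abel_bound_aux f w u v h]
    have h1 : ∀ v, u ≤ v → ∑ i ∈ Finset.Ico u v, (w i - w (i+1)) = w u - w v := by
      intro v hv
      induction v, hv using Nat.le_induction with
      | base => simp
      | succ n hn ih => rw [Finset.sum_Ico_succ_top hn, ih]; ring
    calc _ ≤ |w v * ∑ i ∈ Finset.Ico u v, f i| + |∑ i ∈ Finset.Ico u v, (w i - w (i+1)) * ∑ j ∈ Finset.Ico u (i+1), f j| := abs_add_le _ _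
      _ ≤ w v * Q + ∑ i ∈ Finset.Ico u v, (w i - w (i+1)) * Q := by
        gcongr
        · rw [abs_mul, abs_of_nonneg (hw0 v h)]
          exact mul_le_mul_of_nonneg_left (hQ v) (hw0 v h)
        · refine (Finset.abs_sum_le_sum_abs _ _).trans (Finset.sum_le_sum fun i hi => ?_)
          have hi' := (Finset.mem_Ico.1 hi).1
          rw [abs_mul, abs_of_nonneg (sub_nonneg.2 (hw i hi'))]
          exact mul_le_mul_of_nonneg_left (hQ _) (sub_nonneg.2 (hw i hi'))
      _ = Q * w u := by rw [← Finset.sum_mul, h1 v h]; ring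
  · rw [Finset.Ico_eq_empty_of_le h]; simp; exact mul_nonneg hQ0 (hw0 u le_rfl)

lemma periodic_sum_bound (f : ℕ → ℝ) (q : ℕ) (hq : 0 < q) (hf1 : ∀ n, |f n| ≤ 1)
    (hper : ∀ n, f (n + q) = f n) (h0 : ∑ n ∈ Finset.range q, f n = 0) (u v : ℕ) :
    |∑ i ∈ Finset.Ico u v, f i| ≤ q := by
  have hP : Function.Periodic f q := hper
  have hblock : ∀ n, ∑ i ∈ Finset.Ico n (n+q), f i = 0 := by
    intro n
    induction n with
    | zero => rw [zero_add, ← Finset.range_eq_Ico]; exact h0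
    | succ n ih =>
      rw [Finset.sum_eq_sum_Ico_succ_bot (by omega)] at ih
      rw [show n + 1 + q = (n + q) + 1 by ring, Finset.sum_Ico_succ_top (by omega), hper]
      linarith
  induction hk : v - u using Nat.strong_induction_on generalizing v with
  | _ k ih =>
    by_cases hkq : k < q
    · calc _ ≤ ∑ i ∈ Finset.Ico u v, |f i| := Finset.abs_sum_le_sum_abs _ _
        _ ≤ ∑ i ∈ Finset.Ico u v, 1 := Finset.sum_le_sum fun i _ => hf1 i
        _ ≤ q := by simp; exact_mod_cast (by omega)
    · have := ih (k - q) (by omega) (v - q) (by omega)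
      rw [← Finset.sum_Ico_consecutive f (show u ≤ v - q by omega) (show v - q ≤ v by omega)]
      have h2 := hblock (v - q)
      rw [show v - q + q = v by omega] at h2
      rwa [h2, add_zero]

noncomputable def chi (a : ℤ) (n : ℕ) : ℝ := if Odd n then (jacobiSym a n : ℝ) else 0

lemma chi_zero (a : ℤ) : chi a 0 = 0 := by simp [chi]
lemma chi_one (a : ℤ) : chi a 1 = 1 := by simp [chi]
lemma chi_mul (a : ℤ) (m n : ℕ) : chi a (m * n) = chi a m * chi a n := by
  unfold chi
  by_cases hm : Odd m <;> by_cases hn : Odd n <;> simp [hm, hn, Nat.odd_mul]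
  have : NeZero m := ⟨by rintro rfl; simp at hm⟩
  have : NeZero n := ⟨by rintro rfl; simp at hn⟩
  rw [jacobiSym.mul_right]; push_cast; rfl
lemma chi_mul_left (a b : ℤ) (n : ℕ) : chi (a * b) n = chi a n * chi b n := by
  unfold chi
  by_cases hn : Odd n <;> simp [hn, jacobiSym.mul_left]
lemma chi_trichotomy (a : ℤ) (n : ℕ) : chi a n = 0 ∨ chi a n = 1 ∨ chi a n = -1 := by
  unfold chi
  by_cases hn : Odd n <;> simp [hn]
  rcases jacobiSym.trichotomy a n with h | h | h <;> simp [h]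
lemma chi_abs (a : ℤ) (n : ℕ) : |chi a n| ≤ 1 := by
  rcases chi_trichotomy a n with h | h | h <;> simp [h]
lemma chi_periodic (a : ℤ) (n : ℕ) : chi a (n + 4 * a.natAbs) = chi a n := by
  unfold chi
  have : Odd (n + 4 * a.natAbs) ↔ Odd n := by
    rw [Nat.odd_add]; simp [show Even (4 * a.natAbs) from (by decide : Even 4).mul_right _]
  by_cases hn : Odd n
  · simp only [hn, this, if_true]
    rw [jacobiSym.mod_right a hn, jacobiSym.mod_right a (this.2 hn)]; simp
  · simp [hn, this]

noncomputable def chiHom (a : ℤ) : ℕ →*₀ ℝ where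
  toFun := chi a
  map_zero' := chi_zero a
  map_one' := chi_one a
  map_mul' := chi_mul a

lemma exists_chi_neg_aux {a : ℤ} {u : ℕ} (hodd : Odd u) (h : jacobiSym a u = -1) :
    Nat.Coprime u (4 * a.natAbs) ∧ chi a u = -1 := by
  refine ⟨?_, by simp [chi, hodd, h]⟩
  apply Nat.Coprime.mul_right
  · exact (Nat.Coprime.pow_right 2 (Nat.coprime_two_right.2 hodd) : Nat.Coprime u (2^2))
  · have : NeZero u := ⟨by rintro rfl; simp at hodd⟩
    have h1 := (jacobiSym.eq_zero_iff_not_coprime (a := a) (b := u)).not.1 (by rw [h]; norm_num)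
    rw [not_not, Int.gcd_comm] at h1
    simpa [Int.gcd, Nat.Coprime] using h1

lemma jacobi_eq_one_of_mod (m u : ℕ) (hu : Odd u) (h : u ≡ 1 [MOD 8 * m]) : jacobiSym m u = 1 := by
  rcases Nat.eq_zero_or_pos m with rfl | hm
  · have : u = 1 := by simpa [Nat.ModEq] using h
    subst this; simp
  rw [jacobiSym.mod_right' m hu]
  have h1 : u ≡ 1 [MOD 4 * m] := h.of_dvd ⟨2, by ring⟩
  rw [show u % (4 * m) = 1 % (4*m) from h1, Nat.mod_eq_of_lt (by omega)]; simp

lemma exists_nonres (q : ℕ) (hq : q.Prime) (hq2 : q ≠ 2) : ∃ x : ℕ, jacobiSym x q = -1 := by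
  have : Fact q.Prime := ⟨hq⟩
  obtain ⟨x, hx⟩ := quadraticChar_exists_neg_one (F := ZMod q) (by rwa [ZMod.ringChar_zmod_n])
  refine ⟨x.val, ?_⟩
  rw [← jacobiSym.legendreSym.to_jacobiSym, legendreSym]
  simpa using hx

/-- existence of an odd `u` with `J(a|u) = -1`. -/
lemma exists_chi_neg (a : ℤ) (ha : ¬ IsSquare a) : ∃ u : ℕ, Nat.Coprime u (4 * a.natAbs) ∧ chi a u = -1 := by
  have ha0 : a ≠ 0 := by rintro rfl; simp at ha
  have hn0 : a.natAbs ≠ 0 := by simpa using ha0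
  obtain ⟨b, c, hc, hsf⟩ := Nat.sq_mul_squarefree a.natAbs
  rename' b => c', c => b; rename' c' => c
  have hb0 : b ≠ 0 := by rintro rfl; simp at hc; omega
  have hc0 : c ≠ 0 := by rintro rfl; simp at hc; omega
  by_cases hq : ∃ q : ℕ, q.Prime ∧ q ≠ 2 ∧ q ∣ c
  · obtain ⟨q, hqp, hq2, hqc⟩ := hq
    obtain ⟨x, hx⟩ := exists_nonres q hqp hq2
    set m := ordCompl[q] a.natAbs with hm
    have hcop : Nat.Coprime q (8 * m) := by
      apply Nat.Coprime.mul_right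
      · exact Nat.Coprime.pow_right 3 ((Nat.coprime_primes hqp Nat.prime_two).2 hq2)
      · exact Nat.coprime_ordCompl hqp hn0
    obtain ⟨u, hu1, hu2⟩ := Nat.chineseRemainder hcop x 1
    have hu8 : u % 8 = 1 := (hu2.of_dvd ⟨m, rfl⟩ : u ≡ 1 [MOD 8])
    have hodd : Odd u := Nat.odd_iff.2 (by omega)
    refine ⟨u, exists_chi_neg_aux hodd ?_⟩
    have hqodd : Odd q := hqp.odd_of_ne_two hq2
    have hJq : jacobiSym q u = -1 := by
      rw [jacobiSym.quadratic_reciprocity_one_mod_four' hqodd (by omega), ← hx]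
      apply jacobiSym.mod_left'
      exact_mod_cast hu1
    have hv : Odd (a.natAbs.factorization q) := by
      rw [← hc, Nat.factorization_mul (by positivity) hc0, Nat.factorization_pow]
      have : c.factorization q = 1 := by
        apply le_antisymm (hsf.natFactorization_le_one q)
        exact (hqp.dvd_iff_one_le_factorization hc0).1 hqc
      simp [this]
    have hJn : jacobiSym (a.natAbs : ℤ) u = -1 := by
      rw [← Nat.ordProj_mul_ordCompl_eq_self a.natAbs q]
      push_cast only [Nat.cast_mul, Nat.cast_pow]
      rw [jacobiSym.mul_left, jacobiSym.pow_left, hJq, hv.neg_one_pow,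
        jacobi_eq_one_of_mod _ u hodd hu2, mul_one]
    rcases Int.natAbs_eq a with h | h
    · rw [h]; exact hJn
    · rw [h, jacobiSym.neg _ hodd, hJn, ZMod.χ₄_nat_one_mod_four (by omega)]; norm_num
  · push Not at hq
    have hc2 : c = 1 ∨ c = 2 := by
      have h1 : c = 2 ^ c.primeFactorsList.length :=
        Nat.eq_prime_pow_of_unique_prime_dvd hc0 (fun {d} hd hdc => by
          by_contra h; exact hq d hd h hdc)
      have h2 : c.factorization 2 ≤ 1 := hsf.natFactorization_le_one 2
      rw [h1, Nat.Prime.factorization_pow Nat.prime_two] at h2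
      simp at h2
      interval_cases hh : c.primeFactorsList.length <;> simp_all
    set s := ordCompl[2] b with hs
    have hcop : Nat.Coprime 8 s := Nat.Coprime.pow_left 3 (Nat.coprime_ordCompl Nat.prime_two hb0)
    have key : ∀ r, r % 2 = 1 → r < 8 → ∃ u : ℕ, Odd u ∧ u % 8 = r ∧ jacobiSym ((b:ℤ)^2) u = 1 := by
      intro r hr hr8
      obtain ⟨u, hu1, hu2⟩ := Nat.chineseRemainder hcop r 1
      have hu8 : u % 8 = r := by rw [show u % 8 = r % 8 from hu1]; omega
      have hodd : Odd u := Nat.odd_iff.2 (by omega)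
      refine ⟨u, hodd, hu8, jacobiSym.sq_one' ?_⟩
      have : Nat.Coprime b u := by
        rw [← Nat.ordProj_mul_ordCompl_eq_self b 2]
        apply Nat.Coprime.mul_left
        · exact Nat.Coprime.pow_left _ (Nat.coprime_two_left.2 hodd)
        · have h3 := Nat.ModEq.gcd_eq hu2
          rw [Nat.coprime_comm]; simpa [Nat.Coprime] using h3
      simpa [Int.gcd] using this
    have habs : (a.natAbs : ℤ) = (b:ℤ)^2 * c := by exact_mod_cast hc.symm
    rcases hc2 with rfl | rfl
    · obtain ⟨u, hodd, hu8, hJ⟩ := key 3 (by norm_num) (by norm_num)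
      refine ⟨u, exists_chi_neg_aux hodd ?_⟩
      rcases Int.natAbs_eq a with h | h
      · exfalso; apply ha; rw [h, habs]; exact ⟨b, by push_cast; ring⟩
      · rw [h, jacobiSym.neg _ hodd, habs, ZMod.χ₄_nat_three_mod_four (by omega)]
        simp [hJ]
    · obtain ⟨u, hodd, hu8, hJ⟩ := key 5 (by norm_num) (by norm_num)
      refine ⟨u, exists_chi_neg_aux hodd ?_⟩
      have h2 : jacobiSym 2 u = -1 := by
        rw [jacobiSym.at_two hodd, ZMod.χ₈_nat_eq_if_mod_eight]; simp [hu8]; omega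
      rcases Int.natAbs_eq a with h | h
      · rw [h, habs, jacobiSym.mul_left, hJ]; simpa using h2
      · rw [h, jacobiSym.neg _ hodd, habs, jacobiSym.mul_left, hJ, ZMod.χ₄_nat_one_mod_four (by omega)]; simpa using h2

lemma chi_sum_period (a : ℤ) (ha : ¬ IsSquare a) : ∑ n ∈ Finset.range (4 * a.natAbs), chi a n = 0 := by
  obtain ⟨u, hu, hcu⟩ := exists_chi_neg a ha
  have ha0 : a ≠ 0 := by rintro rfl; simp at ha
  set q := 4 * a.natAbs with hq
  have : NeZero q := ⟨by positivity⟩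
  have hmod : ∀ n, chi a (n % q) = chi a n := fun n => Function.Periodic.map_mod_nat (chi_periodic a) n
  have e1 : ∀ g : ℕ → ℝ, ∑ n ∈ Finset.range q, g n = ∑ x : ZMod q, g x.val := by
    intro g
    symm
    refine Finset.sum_bij (fun x _ => x.val) (fun x _ => Finset.mem_range.2 x.val_lt)
      (fun x _ y _ h => ZMod.val_injective q h) (fun b hb => ⟨(b : ZMod q), Finset.mem_univ _, ?_⟩) (fun _ _ => rfl)
    exact ZMod.val_cast_of_lt (Finset.mem_range.1 hb)
  rw [e1]
  have h2 : ∑ x : ZMod q, chi a x.val = ∑ x : ZMod q, chi a ((ZMod.unitOfCoprime u hu : ZMod q) * x).val := by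
    symm
    exact Fintype.sum_equiv (Units.mulLeft (ZMod.unitOfCoprime u hu)) _ _ (fun x => rfl)
  have h3 : ∀ x : ZMod q, chi a ((ZMod.unitOfCoprime u hu : ZMod q) * x).val = - chi a x.val := by
    intro x
    rw [ZMod.val_mul, hmod, chi_mul]
    simp [ZMod.val_natCast, hmod, hcu]
  simp only [h3, Finset.sum_neg_distrib] at h2
  linarith

lemma chi_sum_bound (a : ℤ) (ha : ¬ IsSquare a) (u v : ℕ) : |∑ i ∈ Finset.Ico u v, chi a i| ≤ 4 * (a.natAbs : ℝ) := by
  have ha0 : a ≠ 0 := by rintro rfl; simp at ha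
  have := periodic_sum_bound (chi a) (4 * a.natAbs) (by positivity) (chi_abs a) (chi_periodic a) (chi_sum_period a ha) u v
  exact_mod_cast this

end

section

open Real

lemma inv_one_sub_le_exp {x : ℝ} (hx : |x| ≤ 1/2) : (1 - x)⁻¹ ≤ exp (x + 2 * x^2) := by
  have h := Real.abs_log_sub_add_sum_range_le (x := x) (by linarith) 1
  have hx1 : 0 < 1 - x := by linarith [le_abs_self x]
  rw [← Real.exp_log (inv_pos.2 hx1), Real.exp_le_exp, Real.log_inv]
  have h2 : |x|^2 / (1 - |x|) ≤ 2 * x^2 := by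
    rw [sq_abs, div_le_iff₀ (by linarith)]
    nlinarith [sq_nonneg x]
  simp at h
  simp at h2
  have := (abs_le.1 (h.trans h2)).1
  linarith

lemma exp_le_inv_one_sub {x : ℝ} (hx : x < 1) : exp x ≤ (1 - x)⁻¹ := by
  rw [le_inv_comm₀ (exp_pos _) (by linarith), ← Real.exp_neg]
  linarith [Real.add_one_le_exp (-x)]

lemma prime_inv_le {p : ℕ} (hp : p.Prime) : (1 / (p:ℝ)) ≤ 1/2 := by
  have : (2:ℝ) ≤ p := by exact_mod_cast hp.two_le
  exact one_div_le_one_div_of_le (by norm_num) this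

lemma sum_prime_sq_le (S : Finset ℕ) : ∑ p ∈ S, 1 / (p:ℝ)^2 ≤ ∑' n : ℕ, 1 / (n:ℝ)^2 :=
  (Real.summable_one_div_nat_pow.2 (by norm_num)).sum_le_tsum S (fun _ _ => by positivity)

noncomputable def psum (N : ℕ) : ℝ := ∑ p ∈ N.primesBelow, 1 / (p:ℝ)

/-- the completely multiplicative function 1/n -/
noncomputable def invHom : ℕ →* ℝ where
  toFun n := 1 / (n:ℝ)
  map_one' := by simp
  map_mul' m n := by push_cast; field_simp

lemma mertens_lower : ∃ C : ℝ, 0 < C ∧ ∀ N : ℕ, 2 ≤ N → log N ≤ C * exp (psum N) := by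
  refine ⟨exp (2 * ∑' n : ℕ, 1 / (n:ℝ)^2), exp_pos _, fun N hN => ?_⟩
  have H := (EulerProduct.summable_and_hasSum_smoothNumbers_prod_primesBelow_geometric (f := invHom)
    (fun {p} hp => by
      simp only [invHom, MonoidHom.coe_mk, OneHom.coe_mk]
      rw [Real.norm_of_nonneg (by positivity)]
      linarith [prime_inv_le hp]) N).2
  have h1 : log N ≤ ∏ p ∈ N.primesBelow, (1 - invHom p)⁻¹ := by
    have h2 : (∑ n ∈ Finset.Icc 1 (N-1), 1/(n:ℝ)) ≤ ∏ p ∈ N.primesBelow, (1 - invHom p)⁻¹ := by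
      have hmem : ∀ n ∈ Finset.Icc 1 (N-1), n ∈ N.smoothNumbers := by
        intro n hn
        rw [Finset.mem_Icc] at hn
        exact Nat.mem_smoothNumbers_of_lt (by omega) (by omega)
      have := sum_le_hasSum ((Finset.Icc 1 (N-1)).attach.map ⟨fun n => (⟨n.1, hmem n.1 n.2⟩ : N.smoothNumbers), by
        intro a b hab; have h9 := congrArg (fun z : N.smoothNumbers => (z : ℕ)) hab; exact Subtype.ext h9⟩) (fun i _ => by simp [invHom]) H
      refine le_trans (le_of_eq ?_) this
      rw [Finset.sum_map, ← Finset.sum_attach]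
      rfl
    refine le_trans ?_ h2
    have h3 := log_add_one_le_harmonic (N-1)
    rw [show N - 1 + 1 = N by omega] at h3
    refine h3.trans (le_of_eq ?_)
    rw [harmonic_eq_sum_Icc]; push_cast; simp
  refine h1.trans ?_
  calc _ ≤ ∏ p ∈ N.primesBelow, exp (1/(p:ℝ) + 2 * (1/(p:ℝ))^2) := by
        refine Finset.prod_le_prod (fun p hp => ?_) (fun p hp => ?_)
        · have := prime_inv_le (Nat.prime_of_mem_primesBelow hp)
          simp only [invHom, MonoidHom.coe_mk, OneHom.coe_mk]
          exact inv_nonneg.2 (by linarith)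
        · have := prime_inv_le (Nat.prime_of_mem_primesBelow hp)
          simp only [invHom, MonoidHom.coe_mk, OneHom.coe_mk]
          exact inv_one_sub_le_exp (by rwa [abs_of_nonneg (by positivity)])
    _ = exp (2 * ∑ p ∈ N.primesBelow, 1/(p:ℝ)^2) * exp (psum N) := by
        rw [← Real.exp_sum, ← Real.exp_add, psum, Finset.mul_sum, ← Finset.sum_add_distrib]
        congr 1; refine Finset.sum_congr rfl fun p _ => ?_
        rw [one_div_pow]; ring
    _ ≤ _ := by
        gcongr; exact sum_prime_sq_le _

lemma pow_div_dvd_factorial (p n : ℕ) (hp : p.Prime) : p ^ (n / p) ∣ n.factorial := by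
  have : ∀ k, p ^ k ∣ (p * k).factorial := by
    intro k
    induction k with
    | zero => simp
    | succ k ih =>
      obtain ⟨r, hr⟩ : ∃ r, p = r + 1 := ⟨p - 1, by have := hp.pos; omega⟩
      rw [show p * (k+1) = (p * k + r) + 1 by rw [mul_add, mul_one]; omega, Nat.factorial_succ, pow_succ, mul_comm]
      refine mul_dvd_mul ⟨k+1, ?_⟩ (ih.trans (Nat.factorial_dvd_factorial (by omega)))
      rw [mul_add, mul_one]; omega
  exact (this _).trans (Nat.factorial_dvd_factorial (Nat.mul_div_le n p))

lemma sum_log_div_le (N : ℕ) (hN : 2 ≤ N) : ∑ p ∈ N.primesBelow, log p / p ≤ 2 * log N := by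
  have h1 : ∏ p ∈ N.primesBelow, p ^ (N / p) ∣ N.factorial := by
    apply Finset.prod_dvd_of_isRelPrime
    · intro p hp q hq hpq
      exact Nat.coprime_iff_isRelPrime.1 (Nat.Coprime.pow _ _ ((Nat.coprime_primes (Nat.prime_of_mem_primesBelow hp) (Nat.prime_of_mem_primesBelow hq)).2 hpq))
    · intro p hp
      exact pow_div_dvd_factorial p N (Nat.prime_of_mem_primesBelow hp)
  have h2 : ∏ p ∈ N.primesBelow, p ^ (N / p) ≤ N ^ N := (Nat.le_of_dvd (Nat.factorial_pos N) h1).trans N.factorial_le_pow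
  have h3 : ∑ p ∈ N.primesBelow, ((N/p : ℕ):ℝ) * log p ≤ N * log N := by
    have h4 : ((∏ p ∈ N.primesBelow, p ^ (N / p) : ℕ) : ℝ) ≤ ((N ^ N : ℕ):ℝ) := by exact_mod_cast h2
    have h5 := Real.log_le_log (by
      have : 0 < ∏ p ∈ N.primesBelow, p ^ (N / p) := Finset.prod_pos fun p hp => pow_pos (Nat.prime_of_mem_primesBelow hp).pos _
      exact_mod_cast this) h4
    push_cast at h5
    rw [Real.log_prod (fun p hp => by
      have := (Nat.prime_of_mem_primesBelow hp).pos
      positivity)] at h5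
    simpa [Real.log_pow] using h5
  have hN0 : (0:ℝ) < N := by exact_mod_cast (by omega : 0 < N)
  have h6 : (N:ℝ)/2 * ∑ p ∈ N.primesBelow, log p / p ≤ N * log N := by
    refine le_trans ?_ h3
    rw [Finset.mul_sum]
    refine Finset.sum_le_sum fun p hp => ?_
    have hpp := (Nat.prime_of_mem_primesBelow hp)
    have hp0 : (0:ℝ) < p := by exact_mod_cast hpp.pos
    have hpN := Nat.lt_of_mem_primesBelow hp
    have h7 : (N:ℝ)/(2 * p) ≤ ((N/p : ℕ):ℝ) := by
      rw [div_le_iff₀ (by positivity)]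
      have a1 := Nat.div_add_mod N p
      have a2 := Nat.mod_lt N hpp.pos
      have a3 : 1 ≤ N / p := (Nat.one_le_div_iff hpp.pos).2 hpN.le
      have : N ≤ (N/p) * (2 * p) := by nlinarith
      exact_mod_cast this
    have h8 : 0 ≤ log p := Real.log_natCast_nonneg p
    calc (N:ℝ)/2 * (log p / p) = (N:ℝ)/(2 * p) * log p := by field_simp
      _ ≤ _ := by gcongr
  have : (N:ℝ) * (∑ p ∈ N.primesBelow, log p / p) ≤ N * (2 * log N) := by linarith
  exact le_of_mul_le_mul_left this hN0

lemma sum_rpow_neg_le (s : ℝ) (hs : 1 < s) (K : ℕ) :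
    ∑ n ∈ Finset.range (K+1), ((n+1 : ℕ):ℝ) ^ (-s) ≤ 1 + (1 - ((K+1 : ℕ):ℝ)^(1-s)) / (s-1) := by
  induction K with
  | zero => simp
  | succ K ih =>
    rw [Finset.sum_range_succ]
    set a : ℝ := ((K + 1 + 1 : ℕ) : ℝ) with ha
    have hb : ((K + 1 : ℕ) : ℝ) = a - 1 := by rw [ha]; push_cast; ring
    have ha2 : 2 ≤ a := by rw [ha]; push_cast; linarith [Nat.cast_nonneg (α := ℝ) K]
    rw [hb] at ih
    have key : (s-1) * a^(-s) ≤ (a-1)^(1-s) - a^(1-s) := by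
      have h1 : a - 1 = a * (1 - 1/a) := by field_simp
      have hx : 0 < 1 - 1/a := by
        have : 1/a ≤ 1/2 := one_div_le_one_div_of_le (by norm_num) ha2
        linarith
      have h2 : (1 - 1/a)^(1-s) ≥ 1 + (s-1)/a := by
        rw [Real.rpow_def_of_pos hx]
        have h3 := Real.log_le_sub_one_of_pos hx
        have h4 : (s-1)/a ≤ log (1 - 1/a) * (1 - s) := by
          have : (s-1)/a = (s-1) * (1/a) := by ring
          rw [this]; nlinarith
        linarith [Real.add_one_le_exp ((s-1)/a), Real.exp_le_exp.2 h4]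
      rw [h1, Real.mul_rpow (by linarith) hx.le]
      have h5 : a^(-s) = a^(1-s) / a := by
        rw [show (-s) = (1 - s) - 1 by ring, Real.rpow_sub_one (by linarith)]
      rw [h5]
      have h6 : 0 < a^(1-s) := Real.rpow_pos_of_pos (by linarith) _
      have := mul_le_mul_of_nonneg_left h2 h6.le
      have h7 : (s-1) * (a^(1-s)/a) = a^(1-s) * (1 + (s-1)/a) - a^(1-s) := by ring
      linarith
    have hs' : 0 < s - 1 := by linarith
    have : a^(-s) ≤ ((a-1)^(1-s) - a^(1-s)) / (s-1) := by rw [le_div_iff₀ hs']; linarith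
    have e : (1 - a^(1-s))/(s-1) = (1 - (a-1)^(1-s))/(s-1) + ((a-1)^(1-s) - a^(1-s)) / (s-1) := by ring
    rw [e]; linarith

noncomputable def rpowHom (s : ℝ) : ℕ →* ℝ where
  toFun n := (n:ℝ) ^ (-s)
  map_one' := by simp
  map_mul' m n := by push_cast; exact Real.mul_rpow (by positivity) (by positivity)

lemma tsum_rpow_le (s : ℝ) (hs : 1 < s) : ∑' n : ℕ, (n:ℝ)^(-s) ≤ 1 + 1/(s-1) := by
  have hsum : Summable (fun n : ℕ => (n:ℝ)^(-s)) := Real.summable_nat_rpow.2 (by linarith)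
  rw [hsum.tsum_eq_zero_add]
  simp only [Nat.cast_zero, Real.zero_rpow (show -s ≠ 0 by linarith), zero_add]
  refine Real.tsum_le_of_sum_range_le (fun n => by positivity) (fun n => ?_)
  refine le_trans (Finset.sum_le_sum_of_subset_of_nonneg (Finset.range_mono (Nat.le_succ n)) (fun _ _ _ => by positivity)) ((sum_rpow_neg_le s hs n).trans ?_)
  have h0 : (0:ℝ) < ((n+1 : ℕ):ℝ)^(1-s) := by positivity
  have h1 : 0 < s - 1 := by linarith
  have h2 : 1 - ((n+1 : ℕ):ℝ)^(1-s) ≤ 1 := by linarith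
  gcongr

lemma mertens_upper : ∃ C : ℝ, 0 < C ∧ ∀ N : ℕ, 2 ≤ N → exp (psum N) ≤ C * log N := by
  refine ⟨exp 2 * (1 / log 2 + 1), by have := Real.log_pos (show (1:ℝ) < 2 by norm_num); positivity, fun N hN => ?_⟩
  have hN2 : (2:ℝ) ≤ N := by exact_mod_cast hN
  have hl2 : 0 < log 2 := Real.log_pos (by norm_num)
  have hlog : log 2 ≤ log N := Real.log_le_log (by norm_num) hN2
  have hL : 0 < log N := by linarith
  set s := 1 + 1 / log N with hs
  have hs1 : 1 < s := by rw [hs]; linarith [one_div_pos.2 hL]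
  have hsum : Summable (rpowHom s) := by
    show Summable (fun n : ℕ => (n:ℝ)^(-s))
    exact Real.summable_nat_rpow.2 (by linarith)
  have hP : ∏ p ∈ N.primesBelow, (1 - rpowHom s p)⁻¹ ≤ 1 + log N := by
    rw [EulerProduct.prod_primesBelow_geometric_eq_tsum_smoothNumbers hsum N]
    have h1 := hsum.tsum_subtype_le (rpowHom s) N.smoothNumbers (fun n => by
      show 0 ≤ (n:ℝ)^(-s)
      positivity)
    refine h1.trans ((tsum_rpow_le s hs1).trans (le_of_eq ?_))
    rw [hs]; simp
  have hlt : ∀ p : ℕ, p.Prime → rpowHom s p < 1 := fun p hp => by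
    have := hsum.norm_lt_one (p := p) hp.one_lt
    exact lt_of_le_of_lt (le_abs_self _) this
  have hE : exp (∑ p ∈ N.primesBelow, rpowHom s p) ≤ 1 + log N := by
    refine le_trans ?_ hP
    rw [Real.exp_sum]
    refine Finset.prod_le_prod (fun p hp => (exp_pos _).le) (fun p hp => ?_)
    exact exp_le_inv_one_sub (hlt p (Nat.prime_of_mem_primesBelow hp))
  have hcmp : psum N ≤ ∑ p ∈ N.primesBelow, rpowHom s p + 2 := by
    have h1 : ∀ p ∈ N.primesBelow, 1/(p:ℝ) ≤ rpowHom s p + (1/log N) * (log p / p) := by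
      intro p hp
      have hp0 : (0:ℝ) < p := by exact_mod_cast (Nat.prime_of_mem_primesBelow hp).pos
      show 1/(p:ℝ) ≤ (p:ℝ)^(-s) + _
      have : (p:ℝ)^(-s) = (1/p) * exp (- (log p / log N)) := by
        rw [hs, show -(1 + 1/log N) = -1 + (-(1/log N)) by ring, Real.rpow_add hp0, Real.rpow_neg_one, Real.rpow_def_of_pos hp0]
        rw [one_div (p:ℝ), show log (p:ℝ) * -(1/log N) = -(log p / log N) by ring]
      rw [this]
      have h2 := Real.add_one_le_exp (- (log p / log N))
      have h3 := mul_le_mul_of_nonneg_left h2 (show 0 ≤ 1/(p:ℝ) by positivity)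
      have h4 : 1/log N * (log p / p) = 1/p * (log p / log N) := by ring
      rw [h4]; linarith
    have h2 := Finset.sum_le_sum h1
    rw [Finset.sum_add_distrib, ← Finset.mul_sum] at h2
    have h3 : 1/log N * ∑ p ∈ N.primesBelow, log p / p ≤ 2 := by
      rw [one_div, inv_mul_le_iff₀ hL, mul_comm]; exact sum_log_div_le N hN
    unfold psum; linarith
  calc exp (psum N) ≤ exp (∑ p ∈ N.primesBelow, rpowHom s p + 2) := Real.exp_le_exp.2 hcmp
    _ = exp 2 * exp (∑ p ∈ N.primesBelow, rpowHom s p) := by rw [Real.exp_add, mul_comm]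
    _ ≤ exp 2 * (1 + log N) := by gcongr
    _ ≤ exp 2 * ((1/log 2 + 1) * log N) := by
        gcongr
        have : 1 ≤ 1/log 2 * log N := by rw [one_div, inv_mul_eq_div, le_div_iff₀ hl2]; linarith
        linarith
    _ = _ := by ring

end

section

open Real

noncomputable def FA (a : ℤ) : ArithmeticFunction ℝ := ⟨fun n => chi a n / n, by simp⟩
noncomputable def GA : ArithmeticFunction ℝ := ⟨fun n => 1 / (n:ℝ), by simp⟩
lemma FA_apply (a : ℤ) (n : ℕ) : FA a n = chi a n / n := rfl
lemma GA_apply (n : ℕ) : GA n = 1 / (n:ℝ) := rfl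
lemma FA_mult (a : ℤ) : (FA a).IsMultiplicative := by
  refine ⟨by simp [FA_apply, chi_one], fun {m n} _ => ?_⟩
  simp only [FA_apply, chi_mul]; push_cast; rw [mul_div_mul_comm]
lemma GA_mult : GA.IsMultiplicative := by
  refine ⟨by simp [GA_apply], fun {m n} _ => ?_⟩
  simp only [GA_apply]; push_cast; rw [one_div_mul_one_div]
noncomputable def RA (a : ℤ) : ArithmeticFunction ℝ := FA a * GA
lemma RA_mult (a : ℤ) : (RA a).IsMultiplicative := (FA_mult a).mul GA_mult
lemma chi_pow (a : ℤ) (p k : ℕ) : chi a (p^k) = chi a p ^ k := map_pow (chiHom a) p k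
lemma RA_prime_pow (a : ℤ) (p k : ℕ) (hp : p.Prime) :
    RA a (p^k) = ∑ j ∈ Finset.range (k+1), (chi a p / p)^j * (1/(p:ℝ))^(k-j) := by
  rw [RA, ArithmeticFunction.mul_apply, Nat.sum_divisorsAntidiagonal (f := fun i j => FA a i * GA j), Nat.sum_divisors_prime_pow hp]
  refine Finset.sum_congr rfl fun j hj => ?_
  rw [Finset.mem_range] at hj
  rw [Nat.pow_div (by omega) hp.pos, FA_apply, GA_apply, chi_pow]
  push_cast
  rw [div_pow, one_div_pow]
lemma RA_prime_pow_nonneg (a : ℤ) (p k : ℕ) (hp : p.Prime) : 0 ≤ RA a (p^k) := by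
  rw [RA_prime_pow a p k hp]
  have : ∑ j ∈ Finset.range (k+1), (chi a p / p)^j * (1/(p:ℝ))^(k-j) = (1/(p:ℝ))^k * ∑ j ∈ Finset.range (k+1), chi a p ^ j := by
    rw [Finset.mul_sum]
    refine Finset.sum_congr rfl fun j hj => ?_
    rw [Finset.mem_range] at hj
    rw [div_eq_mul_one_div, mul_pow, mul_assoc, ← pow_add, show j + (k-j) = k by omega, mul_comm]
  rw [this]
  apply mul_nonneg (by positivity)
  rcases chi_trichotomy a p with h | h | h <;> rw [h]
  · apply Finset.sum_nonneg; intros; positivity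
  · apply Finset.sum_nonneg; intros; positivity
  · rw [neg_one_geom_sum]; split_ifs <;> norm_num
lemma RA_nonneg (a : ℤ) (n : ℕ) : 0 ≤ RA a n := by
  rcases Nat.eq_zero_or_pos n with rfl | hn
  · simp
  rw [(RA_mult a).multiplicative_factorization _ hn.ne']
  apply Finset.prod_nonneg
  intro p hp
  exact RA_prime_pow_nonneg a p _ (Nat.prime_of_mem_primeFactors (by simpa using hp))

lemma chi_div_abs (a : ℤ) {p : ℕ} (hp : p.Prime) : |chi a p / p| ≤ 1/2 := by
  rw [abs_div, Nat.abs_cast]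
  refine le_trans ?_ (prime_inv_le hp)
  gcongr; exact chi_abs a p

lemma RA_sum_le (a : ℤ) (N : ℕ) : ∑ n ∈ Finset.Ioc 0 N, RA a n ≤
    ∏ p ∈ (N+1).primesBelow, ((1 - chi a p / p)⁻¹ * (1 - 1/(p:ℝ))⁻¹) := by
  have hloc : ∀ p : ℕ, p.Prime → Summable (fun n : ℕ ↦ ‖RA a (p ^ n)‖) ∧ ∑' n : ℕ, RA a (p^n) = (1 - chi a p / p)⁻¹ * (1 - 1/(p:ℝ))⁻¹ := by
    intro p hp
    have h1 : ‖chi a p / p‖ < 1 := by rw [Real.norm_eq_abs]; linarith [chi_div_abs a hp]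
    have h2 : ‖1 / (p:ℝ)‖ < 1 := by rw [Real.norm_of_nonneg (by positivity)]; linarith [prime_inv_le hp]
    have hs1 : Summable (fun n : ℕ => ‖(chi a p / p)^n‖) := by
      simp only [norm_pow]; exact summable_geometric_of_lt_one (norm_nonneg _) h1
    have hs2 : Summable (fun n : ℕ => ‖(1/(p:ℝ))^n‖) := by
      simp only [norm_pow]; exact summable_geometric_of_lt_one (norm_nonneg _) h2
    simp only [RA_prime_pow a p _ hp]
    refine ⟨summable_norm_sum_mul_range_of_summable_norm hs1 hs2, ?_⟩
    rw [← tsum_mul_tsum_eq_tsum_sum_range_of_summable_norm hs1 hs2, tsum_geometric_of_norm_lt_one h1, tsum_geometric_of_norm_lt_one h2]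
  have H := (EulerProduct.summable_and_hasSum_smoothNumbers_prod_primesBelow_tsum (f := RA a) (RA_mult a).1
    (fun {m n} h => (RA_mult a).2 h) (fun {p} hp => (hloc p hp).1) (N+1)).2
  rw [Finset.prod_congr rfl (fun p hp => (hloc p (Nat.prime_of_mem_primesBelow hp)).2)] at H
  have hmem : ∀ n ∈ Finset.Ioc 0 N, n ∈ (N+1).smoothNumbers := by
    intro n hn
    rw [Finset.mem_Ioc] at hn
    exact Nat.mem_smoothNumbers_of_lt (by omega) (by omega)
  have := sum_le_hasSum ((Finset.Ioc 0 N).attach.map ⟨fun n => (⟨n.1, hmem n.1 n.2⟩ : (N+1).smoothNumbers), by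
    intro a b hab; have h9 := congrArg (fun z : (N+1).smoothNumbers => (z : ℕ)) hab; exact Subtype.ext h9⟩) (fun i _ => RA_nonneg a _) H
  refine le_trans (le_of_eq ?_) this
  rw [Finset.sum_map, ← Finset.sum_attach]
  rfl

lemma RA_sum_le_exp : ∃ C : ℝ, 0 < C ∧ ∀ (a : ℤ) (N : ℕ), ∑ n ∈ Finset.Ioc 0 N, RA a n ≤
    C * exp (psum (N+1)) * exp (∑ p ∈ (N+1).primesBelow, chi a p / p) := by
  refine ⟨exp (4 * ∑' n : ℕ, 1 / (n:ℝ)^2), exp_pos _, fun a N => (RA_sum_le a N).trans ?_⟩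
  calc _ ≤ ∏ p ∈ (N+1).primesBelow, exp (4 * (1 / (p:ℝ)^2) + 1/(p:ℝ) + chi a p / p) := by
        refine Finset.prod_le_prod (fun p hp => ?_) (fun p hp => ?_)
        · have h1 := prime_inv_le (Nat.prime_of_mem_primesBelow hp)
          have h2 := (abs_le.1 (chi_div_abs a (Nat.prime_of_mem_primesBelow hp))).2
          exact mul_nonneg (inv_nonneg.2 (by linarith)) (inv_nonneg.2 (by linarith))
        · have hpp := Nat.prime_of_mem_primesBelow hp
          have h1 := inv_one_sub_le_exp (chi_div_abs a hpp)
          have h2 := inv_one_sub_le_exp (x := 1/(p:ℝ)) (by rw [abs_of_nonneg (by positivity)]; exact prime_inv_le hpp)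
          have h3 : 0 ≤ (1 - 1/(p:ℝ))⁻¹ := inv_nonneg.2 (by linarith [prime_inv_le hpp])
          refine (mul_le_mul h1 h2 h3 (exp_pos _).le).trans ?_
          rw [← Real.exp_add, Real.exp_le_exp]
          have h4 : (chi a p / p)^2 ≤ 1/(p:ℝ)^2 := by
            rw [div_pow]; gcongr
            have := chi_abs a p
            rw [← sq_abs]; nlinarith [abs_nonneg (chi a p)]
          have h5 : (1/(p:ℝ))^2 = 1/(p:ℝ)^2 := one_div_pow _ _
          linarith
    _ = exp (4 * ∑ p ∈ (N+1).primesBelow, 1 / (p:ℝ)^2) * exp (psum (N+1)) * exp (∑ p ∈ (N+1).primesBelow, chi a p / p) := by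
        rw [← Real.exp_sum, ← Real.exp_add, ← Real.exp_add, psum, Finset.mul_sum, ← Finset.sum_add_distrib, ← Finset.sum_add_distrib]
    _ ≤ _ := by gcongr; exact sum_prime_sq_le _

noncomputable def SU (a : ℤ) (U : ℕ) : ℝ := ∑ m ∈ Finset.Ioc 0 U, chi a m / m
noncomputable def HH (n : ℕ) : ℝ := ∑ k ∈ Finset.Ioc 0 n, 1/(k:ℝ)
lemma HH_eq (n : ℕ) : HH n = harmonic n := by
  rw [harmonic_eq_sum_Icc]; push_cast; simp [HH]; rfl

lemma HH_nonneg (n : ℕ) : 0 ≤ HH n := Finset.sum_nonneg fun _ _ => by positivity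
lemma HH_le (n : ℕ) : HH n ≤ 1 + log n := by
  rw [HH_eq]; exact harmonic_le_one_add_log n

lemma HH_approx (N m : ℕ) (hm : 0 < m) (h : 2 * m ≤ N) :
    |HH (N/m) - (eulerMascheroniConstant + log (N/m))| ≤ 2 * (m/N) := by
  have hN : 0 < N := by omega
  have hm' : (0:ℝ) < m := by exact_mod_cast hm
  have hN' : (0:ℝ) < N := by exact_mod_cast hN
  have hhalf : (m:ℝ)/N ≤ 1/2 := by
    rw [div_le_iff₀ hN']; have : (2:ℝ) * m ≤ N := by exact_mod_cast h
    linarith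
  set x : ℝ := (m:ℝ)/N with hx
  have hx0 : 0 < x := by positivity
  have hxx : (N:ℝ)/m = 1/x := by rw [hx]; simp
  set n := N/m with hn
  have hn1 : 1 ≤ n := (Nat.one_le_div_iff hm).2 (by omega)
  have hnle : (n:ℝ) ≤ 1/x := by rw [← hxx]; exact Nat.cast_div_le
  have hnge : 1/x - 1 ≤ n := by
    rw [← hxx, sub_le_iff_le_add, div_le_iff₀ hm']
    have := Nat.lt_mul_div_succ N hm
    have h2 : (N:ℝ) < m * ((N/m : ℕ) + 1) := by exact_mod_cast this
    rw [← hn] at h2; linarith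
  have e1 := eulerMascheroniSeq_lt_eulerMascheroniConstant n
  have e2 := eulerMascheroniConstant_lt_eulerMascheroniSeq' n
  rw [eulerMascheroniSeq] at e1
  rw [eulerMascheroniSeq', if_neg (by omega)] at e2
  rw [HH_eq, hxx]
  have hlog : log (1/x) = - log x := by rw [one_div, log_inv]
  have h1 : log (n + 1) ≤ log (1/x) + x := by
    have : log ((n:ℝ)+1) ≤ log ((1/x) * (1 + x)) := by
      apply log_le_log (by positivity)
      rw [mul_add, one_div_mul_cancel hx0.ne']; linarith
    rw [log_mul (by positivity) (by positivity)] at this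
    linarith [Real.log_le_sub_one_of_pos (show 0 < 1 + x by linarith)]
  have h2 : log (1/x) - 2 * x ≤ log n := by
    have hpos : 0 < 1 - x := by linarith
    have : log ((1/x) * (1 - x)) ≤ log n := by
      apply log_le_log (by positivity)
      rw [mul_sub, one_div_mul_cancel hx0.ne']; linarith
    rw [log_mul (by positivity) (by positivity)] at this
    have h3 := Real.one_sub_inv_le_log_of_pos hpos
    have h4 : (1-x)⁻¹ ≤ 1 + 2 * x := by
      rw [inv_le_iff_one_le_mul₀ hpos]; nlinarith
    linarith
  rw [abs_le]; constructor <;> linarith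

lemma chi_tail_bound (a : ℤ) (ha : ¬ IsSquare a) (U V : ℕ) (hU : 0 < U) :
    |∑ m ∈ Finset.Ioc U V, chi a m / m| ≤ 4 * a.natAbs / U := by
  have h1 := abel_bound (chi a) (fun m => 1/(m:ℝ)) (4 * (a.natAbs:ℝ)) (U+1) (V+1)
    (fun i hi => by
      apply one_div_le_one_div_of_le
      · exact_mod_cast (by omega : 0 < i)
      · push_cast; linarith) (fun i _ => by positivity) (fun v => chi_sum_bound a ha _ v)
  have h2 : ∑ m ∈ Finset.Ioc U V, chi a m / m = ∑ i ∈ Finset.Ico (U+1) (V+1), 1/(i:ℝ) * chi a i := by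
    rw [show Finset.Ico (U+1) (V+1) = Finset.Ioc U V by ext x; simp]
    exact Finset.sum_congr rfl fun m _ => by ring
  rw [h2]
  refine h1.trans ?_
  rw [mul_one_div]
  have : (0:ℝ) < U := by exact_mod_cast hU
  gcongr; linarith

lemma T_split (a : ℤ) (ha : ¬ IsSquare a) (U N : ℕ) (hU : 0 < U) (hUN : U ≤ N) :
    |∑ n ∈ Finset.Ioc 0 N, RA a n - ∑ m ∈ Finset.Ioc 0 U, chi a m / m * HH (N/m)| ≤ 4 * a.natAbs / U * (1 + log N) := by
  rw [RA, ArithmeticFunction.sum_Ioc_mul_eq_sum_sum]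
  have h1 : ∑ n ∈ Finset.Ioc 0 N, FA a n * ∑ m ∈ Finset.Ioc 0 (N/n), GA m = ∑ m ∈ Finset.Ioc 0 U, chi a m / m * HH (N/m) + ∑ m ∈ Finset.Ioc U N, chi a m / m * HH (N/m) := by
    rw [Finset.sum_Ioc_consecutive _ (Nat.zero_le U) hUN]; rfl
  rw [h1, add_sub_cancel_left]
  have h2 : ∑ m ∈ Finset.Ioc U N, chi a m / m * HH (N/m) = ∑ k ∈ Finset.Ioc 0 N, (1/(k:ℝ)) * ∑ m ∈ Finset.Ioc U (N/k), chi a m / m := by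
    simp only [HH, Finset.mul_sum]
    rw [Finset.sum_comm' (t' := Finset.Ioc 0 N) (s' := fun k => Finset.Ioc U (N/k))]
    · refine Finset.sum_congr rfl fun k _ => Finset.sum_congr rfl fun m _ => by ring
    · intro m k
      simp only [Finset.mem_Ioc]
      constructor
      · rintro ⟨⟨h1, h2⟩, h3, h4⟩
        have hm : 0 < m := by omega
        have h5 := (Nat.le_div_iff_mul_le hm).1 h4
        refine ⟨⟨h1, (Nat.le_div_iff_mul_le h3).2 (by linarith)⟩, h3, ?_⟩
        nlinarith
      · rintro ⟨⟨h1, h2⟩, h3, h4⟩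
        have hm : 0 < m := by omega
        have h5 := (Nat.le_div_iff_mul_le h3).1 h2
        refine ⟨⟨h1, by nlinarith⟩, h3, (Nat.le_div_iff_mul_le hm).2 (by linarith)⟩
  rw [h2]
  calc _ ≤ ∑ k ∈ Finset.Ioc 0 N, (1/(k:ℝ)) * (4 * a.natAbs / U) := by
        refine (Finset.abs_sum_le_sum_abs _ _).trans (Finset.sum_le_sum fun k _ => ?_)
        rw [abs_mul, abs_of_nonneg (show (0:ℝ) ≤ 1/(k:ℝ) by positivity)]
        gcongr
        exact chi_tail_bound a ha U _ hU
    _ = 4 * a.natAbs / U * HH N := by rw [← Finset.sum_mul, HH, mul_comm]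
    _ ≤ _ := by gcongr; exact HH_le N

lemma SU_bound (a : ℤ) (ha : ¬ IsSquare a) (U N₁ N₂ : ℕ) (hU : 0 < U) (hU1 : 2 * U ≤ N₁) (h12 : N₁ ≤ N₂) :
    (log N₂ - log N₁) * SU a U ≤ ∑ n ∈ Finset.Ioc 0 N₂, RA a n + 4 * U / N₁ + 2 * (4 * a.natAbs / U * (1 + log N₂)) := by
  have t1 := (abs_le.1 (T_split a ha U N₁ hU (by omega))).2
  have t2 := (abs_le.1 (T_split a ha U N₂ hU (by omega))).1
  have hN1 : (0:ℝ) < N₁ := by exact_mod_cast (by omega : 0 < N₁)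
  have hN12 : (N₁:ℝ) ≤ N₂ := by exact_mod_cast h12
  have hlog : log N₁ ≤ log N₂ := log_le_log hN1 hN12
  have hq : 4 * (a.natAbs:ℝ) / U * (1 + log N₁) ≤ 4 * a.natAbs / U * (1 + log N₂) := by gcongr
  have hT1 : 0 ≤ ∑ n ∈ Finset.Ioc 0 N₁, RA a n := Finset.sum_nonneg fun n _ => RA_nonneg a n
  have main : |(∑ m ∈ Finset.Ioc 0 U, chi a m / m * HH (N₂/m) - ∑ m ∈ Finset.Ioc 0 U, chi a m / m * HH (N₁/m)) - (log N₂ - log N₁) * SU a U| ≤ 4 * U / N₁ := by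
    rw [SU, Finset.mul_sum, ← Finset.sum_sub_distrib, ← Finset.sum_sub_distrib]
    refine (Finset.abs_sum_le_sum_abs _ _).trans ?_
    calc _ ≤ ∑ m ∈ Finset.Ioc 0 U, 4 / (N₁:ℝ) := by
          refine Finset.sum_le_sum fun m hm => ?_
          rw [Finset.mem_Ioc] at hm
          have hm0 : (0:ℝ) < m := by exact_mod_cast hm.1
          have a1 := HH_approx N₁ m hm.1 (by omega)
          have a2 := HH_approx N₂ m hm.1 (by omega)
          rw [log_div (by positivity) (by positivity)] at a1
          rw [log_div (by linarith) (by positivity)] at a2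
          have a3 : (m:ℝ)/N₂ ≤ m/N₁ := by gcongr
          have e : chi a m / m * HH (N₂/m) - chi a m / m * HH (N₁/m) - (log N₂ - log N₁) * (chi a m / m) = chi a m / m * ((HH (N₂/m) - (eulerMascheroniConstant + (log N₂ - log m))) - (HH (N₁/m) - (eulerMascheroniConstant + (log N₁ - log m)))) := by ring
          rw [e, abs_mul]
          have a4 : |chi a m / m| ≤ 1/m := by
            rw [abs_div, Nat.abs_cast]; gcongr; exact chi_abs a m
          have a5 := (abs_sub (HH (N₂/m) - (eulerMascheroniConstant + (log N₂ - log m))) (HH (N₁/m) - (eulerMascheroniConstant + (log N₁ - log m))))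
          calc _ ≤ (1/(m:ℝ)) * (4 * (m/N₁)) := by
                  apply mul_le_mul a4 (by linarith) (abs_nonneg _) (by positivity)
            _ = 4/N₁ := by field_simp
      _ = 4 * U / N₁ := by simp; ring
  have m1 := (abs_le.1 main).1
  linarith

end

section

open Real

lemma primesBelow_subset {a b : ℕ} (h : a ≤ b) : a.primesBelow ⊆ b.primesBelow := by
  intro p hp
  rw [Nat.mem_primesBelow] at *
  exact ⟨by omega, hp.2⟩

lemma chi_psum_abs (a : ℤ) (S : Finset ℕ) : |∑ p ∈ S, chi a p / p| ≤ ∑ p ∈ S, 1/(p:ℝ) := by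
  refine (Finset.abs_sum_le_sum_abs _ _).trans (Finset.sum_le_sum fun p _ => ?_)
  rw [abs_div, Nat.abs_cast]
  gcongr; exact chi_abs a p

lemma lemmaB (A : ℝ) (hA : 0 < A) : ∃ C : ℝ, 0 < C ∧ ∀ (a : ℤ) (X Y : ℕ), ¬ IsSquare a → 2 ≤ Y → Y ≤ X →
    4 * (a.natAbs : ℝ) ≤ A * X →
    SU a (X^2) + 4 * a.natAbs / ((X^2 : ℕ):ℝ) ≤ C * (log X / log Y) * exp (∑ p ∈ Y.primesBelow, chi a p / p) := by
  obtain ⟨C1, hC1, h1⟩ := RA_sum_le_exp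
  obtain ⟨C2, hC2, h2⟩ := mertens_upper
  obtain ⟨C3, hC3, h3⟩ := mertens_lower
  refine ⟨C1 * (9 * C2)^2 * C3 + (2 + 6 * A) * C2, by positivity, fun a X Y ha hY hYX haX => ?_⟩
  have hX2 : (2:ℝ) ≤ X := by exact_mod_cast (by omega : 2 ≤ X)
  have hY2 : (2:ℝ) ≤ Y := by exact_mod_cast hY
  have hl2 : 1/2 < log 2 := by linarith [Real.log_two_gt_d9]
  have hlY : log 2 ≤ log Y := Real.log_le_log (by norm_num) hY2
  have hYX' : log Y ≤ log X := Real.log_le_log (by linarith) (by exact_mod_cast hYX)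
  set L := log X with hL
  set E := exp (∑ p ∈ Y.primesBelow, chi a p / p) with hE
  have hlY0 : 0 < log Y := by linarith
  have hL0 : 0 < L := by linarith
  have hXX : X ≤ X^2 := by nlinarith
  have hX4 : 2 * X^2 ≤ X^4 := by
    have : 4 ≤ X^2 := by nlinarith
    nlinarith
  have hb := SU_bound a ha (X^2) (X^4) (X^8) (by nlinarith) hX4 (Nat.pow_le_pow_right (by omega) (by norm_num))
  push_cast at hb ⊢
  rw [Real.log_pow, Real.log_pow, ← hL] at hb
  push_cast at hb
  -- main term
  have hmain : ∑ n ∈ Finset.Ioc 0 (X^8), RA a n ≤ C1 * (9 * C2)^2 * C3 * (L * (L / log Y)) * E := by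
    refine (h1 a (X^8)).trans ?_
    have hP : Y ≤ X^8 + 1 := by
      have : X ≤ X^8 := Nat.le_self_pow (by norm_num) X
      omega
    have hsplit : ∑ p ∈ (X^8+1).primesBelow, chi a p / p ≤ ∑ p ∈ Y.primesBelow, chi a p / p + (psum (X^8+1) - psum Y) := by
      unfold psum
      rw [← Finset.sum_sdiff (primesBelow_subset hP), ← Finset.sum_sdiff (primesBelow_subset hP) (f := fun p : ℕ => 1/(p:ℝ))]
      have := (abs_le.1 (chi_psum_abs a ((X^8+1).primesBelow \ Y.primesBelow))).2
      linarith
    have hlogP : log ((X^8+1 : ℕ):ℝ) ≤ 9 * L := by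
      rw [hL, show (9:ℝ) * log X = log ((X:ℝ)^9) by rw [Real.log_pow]; norm_num]
      apply Real.log_le_log (by positivity)
      push_cast
      have : (1:ℝ) ≤ (X:ℝ)^8 := one_le_pow₀ (by linarith)
      nlinarith
    have hpsP : exp (psum (X^8+1)) ≤ 9 * C2 * L := by
      refine (h2 _ (by omega)).trans ?_
      calc C2 * log ((X^8+1 : ℕ):ℝ) ≤ C2 * (9 * L) := by gcongr
        _ = _ := by ring
    have hpsY : exp (- psum Y) ≤ C3 / log Y := by
      rw [Real.exp_neg, inv_le_comm₀ (exp_pos _) (by positivity), inv_div, div_le_iff₀ hC3, mul_comm]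
      exact h3 Y hY
    calc C1 * exp (psum (X^8+1)) * exp (∑ p ∈ (X^8+1).primesBelow, chi a p / p)
        ≤ C1 * exp (psum (X^8+1)) * exp (∑ p ∈ Y.primesBelow, chi a p / p + (psum (X^8+1) - psum Y)) := by gcongr
      _ = C1 * exp (psum (X^8+1)) * (E * (exp (psum (X^8+1)) * exp (- psum Y))) := by
          rw [hE, ← Real.exp_add (psum _), ← Real.exp_add, ← sub_eq_add_neg]
      _ ≤ C1 * (9 * C2 * L) * (E * ((9 * C2 * L) * (C3 / log Y))) := by
          have : 0 < E := exp_pos _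
          gcongr
      _ = _ := by ring
  have hEX : 1 / (X:ℝ) ≤ C2 * (L / log Y * E) := by
    have e1 : exp (- psum Y) ≤ E := by
      apply Real.exp_le_exp.2
      exact (abs_le.1 (chi_psum_abs a _)).1
    have e2 : 1 / (C2 * log Y) ≤ exp (- psum Y) := by
      rw [Real.exp_neg, one_div]
      exact inv_anti₀ (exp_pos _) (h2 Y hY)
    have e3 : 1 ≤ L / log Y := by rw [one_le_div hlY0]; exact hYX'
    have e4 : log Y ≤ X := by
      have := Real.log_le_sub_one_of_pos (show (0:ℝ) < X by linarith)
      linarith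
    calc 1 / (X:ℝ) ≤ 1 / log Y := one_div_le_one_div_of_le hlY0 e4
      _ = C2 * (1 * (1 / (C2 * log Y))) := by field_simp
      _ ≤ _ := by
        have := e2.trans e1
        gcongr
  have hX0 : (0:ℝ) < X := by linarith
  have herr1 : 4 * (a.natAbs:ℝ) / (X:ℝ)^2 ≤ A / X := by
    rw [div_le_div_iff₀ (by positivity) hX0]
    nlinarith
  have herr2 : 4 * (X:ℝ)^2 / (X:ℝ)^4 ≤ 4 / X := by
    rw [div_le_div_iff₀ (by positivity) hX0]
    have : (X:ℝ)^3 ≤ (X:ℝ)^4 := pow_le_pow_right₀ (by linarith) (by norm_num)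
    nlinarith
  have hLb : 4 * L * SU a (X^2) ≤ C1 * (9 * C2)^2 * C3 * (L * (L / log Y)) * E + 4 / X + 2 * (A / X * (1 + 8 * L)) := by
    have : 4 * (a.natAbs:ℝ) / (X:ℝ)^2 * (1 + 8 * L) ≤ A / X * (1 + 8 * L) := by gcongr
    nlinarith
  have hfin : SU a (X^2) ≤ C1 * (9 * C2)^2 * C3 * (L / log Y) * E + (2 + 5 * A) * (1/X) := by
    have hE0 : 0 < E := exp_pos _
    have hq : 0 ≤ C1 * (9 * C2)^2 * C3 * (L / log Y) * E := by positivity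
    have hx : 0 < 1 / (X:ℝ) := by positivity
    have e1 : A / X * (1 + 8 * L) ≤ 10 * L * A * (1/X) := by
      have : 1 + 8 * L ≤ 10 * L := by linarith
      calc _ ≤ A / X * (10 * L) := by gcongr
        _ = _ := by ring
    have e2 : 4 / (X:ℝ) ≤ 8 * L * (1/X) := by
      rw [div_eq_mul_one_div]; gcongr; linarith
    have : 4 * L * SU a (X^2) ≤ 4 * L * (C1 * (9 * C2)^2 * C3 * (L / log Y) * E + (2 + 5 * A) * (1/X)) := by
      have h5 : C1 * (9 * C2)^2 * C3 * (L * (L / log Y)) * E = L * (C1 * (9 * C2)^2 * C3 * (L / log Y) * E) := by ring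
      rw [h5] at hLb
      nlinarith
    exact le_of_mul_le_mul_left this (by positivity)
  calc _ ≤ C1 * (9 * C2)^2 * C3 * (L / log Y) * E + (2 + 5 * A) * (1/X) + A / X := add_le_add hfin herr1
    _ = C1 * (9 * C2)^2 * C3 * (L / log Y) * E + (2 + 6 * A) * (1/X) := by ring
    _ ≤ C1 * (9 * C2)^2 * C3 * (L / log Y) * E + (2 + 6 * A) * (C2 * (L / log Y * E)) := by gcongr
    _ = _ := by ring

end

section

open Real

lemma exists_jacobi_neg (n : ℕ) (hn : Odd n) (hsq : ¬ IsSquare n) : ∃ u : ℕ, Nat.Coprime u n ∧ jacobiSym u n = -1 := by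
  have hn0 : n ≠ 0 := by rintro rfl; simp at hsq
  have : ∃ q : ℕ, q.Prime ∧ Odd (n.factorization q) := by
    by_contra! h
    apply hsq
    refine ⟨n.factorization.prod (fun p k => p ^ (k/2)), ?_⟩
    rw [← Finsupp.prod_mul]
    conv_lhs => rw [← Nat.prod_factorization_pow_eq_self hn0]
    refine Finsupp.prod_congr fun p hp => ?_
    have := h p (Nat.prime_of_mem_primeFactors (by simpa using hp))
    rw [Nat.not_odd_iff_even] at this
    rw [← pow_add]; congr 1
    obtain ⟨k, hk⟩ := this
    omega
  obtain ⟨q, hq, hk⟩ := this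
  set k := n.factorization q
  have hq2 : q ≠ 2 := by
    rintro rfl
    have : ¬ 2 ∣ n := by rw [← even_iff_two_dvd]; simpa using hn
    simp [k, Nat.factorization_eq_zero_of_not_dvd this] at hk
  set m := n / q^k with hm
  have hnm : n = q^k * m := (Nat.ordProj_mul_ordCompl_eq_self n q).symm
  have hcop : Nat.Coprime q m := Nat.coprime_ordCompl hq hn0
  obtain ⟨x, hx⟩ := exists_nonres q hq hq2
  obtain ⟨u, hu1, hu2⟩ := Nat.chineseRemainder hcop x 1
  have hm0 : NeZero m := ⟨by rintro h; rw [h] at hnm; simp at hnm; exact hn0 hnm⟩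
  have hq0 : NeZero q := ⟨hq.ne_zero⟩
  have hj : jacobiSym u n = -1 := by
    rw [hnm, jacobiSym.mul_right, jacobiSym.pow_right]
    have e1 : jacobiSym u q = -1 := by
      rw [← hx]; exact jacobiSym.mod_left' (by exact_mod_cast hu1)
    have e2 : jacobiSym u m = 1 := by
      rw [← jacobiSym.one_left m]
      exact jacobiSym.mod_left' (by exact_mod_cast hu2)
    rw [e1, e2, hk.neg_one_pow]; norm_num
  refine ⟨u, ?_, hj⟩
  have : jacobiSym u n ≠ 0 := by rw [hj]; norm_num
  have hn0' : NeZero n := ⟨hn0⟩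
  rw [Ne, jacobiSym.eq_zero_iff_not_coprime, not_not] at this
  simpa [Nat.Coprime] using this

lemma jac_sum_period (n : ℕ) (hn : Odd n) (hsq : ¬ IsSquare n) : ∑ i ∈ Finset.range n, (jacobiSym i n : ℝ) = 0 := by
  obtain ⟨u, hu, hcu⟩ := exists_jacobi_neg n hn hsq
  have : NeZero n := ⟨by rintro rfl; simp at hsq⟩
  have key : ∑ x : ZMod n, (jacobiSym x.val n : ℝ) = - ∑ x : ZMod n, (jacobiSym x.val n : ℝ) := by
    have hU : IsUnit ((u:ℕ) : ZMod n) := (ZMod.isUnit_iff_coprime u n).2 hu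
    obtain ⟨U, hU⟩ := hU
    conv_lhs => rw [← Equiv.sum_comp (Units.mulLeft U)]
    rw [← Finset.sum_neg_distrib]
    refine Finset.sum_congr rfl fun x _ => ?_
    have : jacobiSym ((Units.mulLeft U x).val : ℕ) n = jacobiSym ((u * x.val : ℕ)) n := by
      apply jacobiSym.mod_left'
      norm_cast
      rw [Units.mulLeft_apply, hU, ZMod.val_mul, ZMod.val_natCast]
      simp
    rw [this]; push_cast
    rw [jacobiSym.mul_left, hcu]; push_cast; ring
  have h2 : ∑ x : ZMod n, (jacobiSym x.val n : ℝ) = ∑ i ∈ Finset.range n, (jacobiSym i n : ℝ) := by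
    rw [← Fin.sum_univ_eq_sum_range (fun i => (jacobiSym i n : ℝ))]
    obtain ⟨k, rfl⟩ : ∃ k, n = k + 1 := ⟨n-1, by have := NeZero.ne n; omega⟩
    rfl
  linarith

lemma jac_sum_bound (n : ℕ) (hn : Odd n) (hsq : ¬ IsSquare n) (X : ℕ) :
    |∑ D ∈ Finset.Icc (-(X:ℤ)) X, (jacobiSym D n : ℝ)| ≤ n := by
  have hn0 : 0 < n := hn.pos
  have hb := periodic_sum_bound (fun i : ℕ => (jacobiSym i n : ℝ)) n hn0
    (fun i => by rcases jacobiSym.trichotomy i n with h | h | h <;> simp [h])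
    (fun i => by
      congr 1
      apply jacobiSym.mod_left'; push_cast; simp) (jac_sum_period n hn hsq) (X*(n-1)) (X*(n-1)+(2*X+1))
  have : ∑ D ∈ Finset.Icc (-(X:ℤ)) X, (jacobiSym D n : ℝ) = ∑ i ∈ Finset.Ico (X*(n-1)) (X*(n-1)+(2*X+1)), (jacobiSym i n : ℝ) := by
    refine (Finset.sum_bij (fun (i:ℕ) _ => (i:ℤ) - X * n) ?_ ?_ ?_ ?_).symm
    · intro i hi
      simp only [Finset.mem_Ico, Finset.mem_Icc] at *
      have : ((X * (n-1) : ℕ):ℤ) = X * n - X := by push_cast [Nat.cast_sub hn0]; ring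
      omega
    · intro i _ j _ h; simpa using h
    · intro D hD
      simp only [Finset.mem_Ico, Finset.mem_Icc] at *
      have : ((X * (n-1) : ℕ):ℤ) = X * n - X := by push_cast [Nat.cast_sub hn0]; ring
      refine ⟨(D + X * n).toNat, ?_, ?_⟩
      · omega
      · have : 0 ≤ D + X * n := by
          have := Nat.zero_le (X*(n-1)); omega
        rw [Int.toNat_of_nonneg this]; ring
    · intro i _
      congr 1
      apply jacobiSym.mod_left'; simp [Int.sub_emod]
  rw [this]; exact hb

/-- sign function -/
noncomputable def sg (S : Finset ℕ) (k : ℕ) : ℝ := ∏ p ∈ S, (-1:ℝ)^(k.factorization p)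

lemma sg_mul (S : Finset ℕ) (k l : ℕ) (hk : k ≠ 0) (hl : l ≠ 0) : sg S (k*l) = sg S k * sg S l := by
  simp [sg, Nat.factorization_mul hk hl, pow_add, Finset.prod_mul_distrib]

lemma sg_sum (P : Finset ℕ) (k : ℕ) : ∑ S ∈ P.powerset, sg S k = ∏ p ∈ P, (1 + (-1:ℝ)^(k.factorization p)) := by
  rw [Finset.prod_one_add]; rfl

lemma base_case (P : Finset ℕ) (X k : ℕ) (hk : k ≠ 0) :
    ∑ D ∈ Finset.Icc (-(X:ℤ)) X, chi D k ≤ (2*X+1) * ((2:ℝ)^P.card)⁻¹ * ∑ S ∈ P.powerset, sg S k + k := by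
  rw [sg_sum]
  have hnn : 0 ≤ ∏ p ∈ P, (1 + (-1:ℝ)^(k.factorization p)) := by
    apply Finset.prod_nonneg
    intro p _
    rcases neg_one_pow_eq_or ℝ (k.factorization p) with h | h <;> rw [h] <;> norm_num
  by_cases hs : IsSquare k
  · have : ∏ p ∈ P, (1 + (-1:ℝ)^(k.factorization p)) = 2^P.card := by
      rw [Finset.prod_congr rfl (g := fun _ => (2:ℝ)), Finset.prod_const]
      intro p _
      obtain ⟨r, rfl⟩ := hs
      have : r ≠ 0 := by rintro rfl; simp at hk
      rw [Nat.factorization_mul this this, Finsupp.add_apply, Even.neg_one_pow ⟨_, rfl⟩]; norm_num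
    rw [this, mul_assoc, inv_mul_cancel₀ (by positivity), mul_one]
    calc _ ≤ ∑ D ∈ Finset.Icc (-(X:ℤ)) X, (1:ℝ) := Finset.sum_le_sum fun D _ => (le_abs_self _).trans (chi_abs D k)
      _ = 2*X+1 := by
        simp
        have : ((X:ℤ) + 1 + X).toNat = 2 * X + 1 := by omega
        rw [this]; push_cast; ring
      _ ≤ _ := by linarith [(Nat.cast_nonneg k : (0:ℝ) ≤ k)]
  · have h0 : 0 ≤ (2*X+1) * ((2:ℝ)^P.card)⁻¹ * ∏ p ∈ P, (1 + (-1:ℝ)^(k.factorization p)) := by positivity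
    have : ∑ D ∈ Finset.Icc (-(X:ℤ)) X, chi D k ≤ k := by
      unfold chi
      by_cases ho : Odd k
      · simp only [ho, if_true]
        exact (le_abs_self _).trans (jac_sum_bound k ho hs X)
      · simp [ho]
    linarith

lemma moment_induct (P : Finset ℕ) (hP : ∀ p ∈ P, p ≠ 0) (b : ℕ → ℝ) (hb : ∀ p ∈ P, 0 ≤ b p) (X m : ℕ) : ∀ (k : ℕ) (_ : k ≠ 0),
    ∑ D ∈ Finset.Icc (-(X:ℤ)) X, chi D k * (1 + ∑ p ∈ P, b p * chi D p)^m ≤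
      (2*X+1) * ((2:ℝ)^P.card)⁻¹ * ∑ S ∈ P.powerset, sg S k * (1 + ∑ p ∈ P, b p * sg S p)^m
        + k * (1 + ∑ p ∈ P, b p * p)^m := by
  induction m with
  | zero => intro k hk; simpa using base_case P X k hk
  | succ m ih =>
    intro k hk
    have e1 : ∀ D : ℤ, chi D k * (1 + ∑ p ∈ P, b p * chi D p)^(m+1) = chi D k * (1 + ∑ p ∈ P, b p * chi D p)^m +
        ∑ p ∈ P, b p * (chi D (k*p) * (1 + ∑ p ∈ P, b p * chi D p)^m) := by
      intro D
      have : ∀ p ∈ P, b p * (chi D (k*p) * (1 + ∑ p ∈ P, b p * chi D p)^m) = (b p * chi D p) * (chi D k * (1 + ∑ p ∈ P, b p * chi D p)^m) := by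
        intro p _; rw [chi_mul]; ring
      rw [Finset.sum_congr rfl this, ← Finset.sum_mul]; ring
    have e2 : ∀ S : Finset ℕ, sg S k * (1 + ∑ p ∈ P, b p * sg S p)^(m+1) = sg S k * (1 + ∑ p ∈ P, b p * sg S p)^m +
        ∑ p ∈ P, b p * (sg S (k*p) * (1 + ∑ p ∈ P, b p * sg S p)^m) := by
      intro S
      have : ∀ p ∈ P, b p * (sg S (k*p) * (1 + ∑ p ∈ P, b p * sg S p)^m) = (b p * sg S p) * (sg S k * (1 + ∑ p ∈ P, b p * sg S p)^m) := by
        intro p hp; rw [sg_mul S k p hk (hP p hp)]; ring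
      rw [Finset.sum_congr rfl this, ← Finset.sum_mul]; ring
    have e3 : (k:ℝ) * (1 + ∑ p ∈ P, b p * p)^(m+1) = k * (1 + ∑ p ∈ P, b p * p)^m +
        ∑ p ∈ P, b p * (((k*p : ℕ):ℝ) * (1 + ∑ p ∈ P, b p * p)^m) := by
      have : ∀ p ∈ P, b p * (((k*p : ℕ):ℝ) * (1 + ∑ p ∈ P, b p * p)^m) = (b p * p) * (k * (1 + ∑ p ∈ P, b p * p)^m) := by
        intro p _; push_cast; ring
      rw [Finset.sum_congr rfl this, ← Finset.sum_mul]; ring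
    simp only [e1, e2, Finset.sum_add_distrib]
    rw [e3, Finset.sum_comm, Finset.sum_comm (s := P.powerset)]
    simp only [← Finset.mul_sum]
    have h1 := ih k hk
    have h2 : ∑ p ∈ P, b p * ∑ D ∈ Finset.Icc (-(X:ℤ)) X, chi D (k*p) * (1 + ∑ p ∈ P, b p * chi D p)^m ≤
        ∑ p ∈ P, b p * ((2*X+1) * ((2:ℝ)^P.card)⁻¹ * ∑ S ∈ P.powerset, sg S (k*p) * (1 + ∑ p ∈ P, b p * sg S p)^m
        + ((k*p:ℕ):ℝ) * (1 + ∑ p ∈ P, b p * p)^m) :=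
      Finset.sum_le_sum fun p hp => mul_le_mul_of_nonneg_left (ih (k*p) (mul_ne_zero hk (hP p hp))) (hb p hp)
    refine (add_le_add h1 h2).trans (le_of_eq ?_)
    simp only [mul_add, Finset.sum_add_distrib, Finset.mul_sum]
    have : ∀ p ∈ P, ∑ S ∈ P.powerset, b p * ((2*X+1) * ((2:ℝ)^P.card)⁻¹ * (sg S (k*p) * (1 + ∑ p ∈ P, b p * sg S p)^m)) = ∑ S ∈ P.powerset, (2*X+1) * ((2:ℝ)^P.card)⁻¹ * (b p * (sg S (k*p) * (1 + ∑ p ∈ P, b p * sg S p)^m)) := fun p _ => Finset.sum_congr rfl fun S _ => by ring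
    rw [← Finset.sum_congr rfl this]
    push_cast
    ring

lemma sg_prime (P S : Finset ℕ) (hP : ∀ p ∈ P, p.Prime) (hS : S ⊆ P) (p : ℕ) (hp : p ∈ P) : sg S p = if p ∈ S then -1 else 1 := by
  unfold sg
  have : ∀ q ∈ S, (-1:ℝ)^(p.factorization q) = if q = p then -1 else 1 := by
    intro q hq
    rw [(hP p hp).factorization, Finsupp.single_apply]
    by_cases h : p = q
    · simp [h]
    · simp [h, Ne.symm h]
  rw [Finset.prod_congr rfl this, Finset.prod_ite_eq']

lemma sg_exp_sum (P : Finset ℕ) (hP : ∀ p ∈ P, p.Prime) (a : ℕ → ℝ) :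
    ((2:ℝ)^P.card)⁻¹ * ∑ S ∈ P.powerset, exp (∑ p ∈ P, a p * sg S p) ≤ exp (∑ p ∈ P, a p ^ 2 / 2) := by
  have h : ∀ S ∈ P.powerset, exp (∑ p ∈ P, a p * sg S p) = (∏ p ∈ S, exp (- a p)) * ∏ p ∈ P \ S, exp (a p) := by
    intro S hS
    rw [Finset.mem_powerset] at hS
    rw [← Real.exp_sum, ← Real.exp_sum, ← Real.exp_add, ← Finset.sum_sdiff hS, add_comm]
    congr 2
    · exact Finset.sum_congr rfl fun p hp => by rw [sg_prime P S hP hS p (hS hp)]; simp [hp]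
    · exact Finset.sum_congr rfl fun p hp => by
        rw [Finset.mem_sdiff] at hp
        rw [sg_prime P S hP hS p hp.1]; simp [hp.2]
  rw [Finset.sum_congr rfl h, ← Finset.prod_add, Real.exp_sum, ← Finset.prod_const, ← Finset.prod_inv_distrib, ← Finset.prod_mul_distrib]
  refine Finset.prod_le_prod (fun p _ => by positivity) fun p _ => ?_
  refine le_trans (le_of_eq ?_) (Real.cosh_le_exp_half_sq (a p))
  rw [Real.cosh_eq]; ring

end

section

open Real

lemma exp_le_pow (x : ℝ) (m : ℕ) (hm : 4 ≤ m) (hx : x^2 ≤ m) : exp x ≤ exp 2 * (1 + x/m)^m := by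
  have hm0 : (4:ℝ) ≤ m := by exact_mod_cast hm
  have habs : |x/m| ≤ 1/2 := by
    rw [abs_div, Nat.abs_cast, div_le_div_iff₀ (by linarith) (by norm_num)]
    apply abs_le_of_sq_le_sq' _ (by positivity) |>.2
    rw [mul_pow, sq_abs]; nlinarith
  have h1 := inv_one_sub_le_exp (x := -(x/m)) (by rwa [abs_neg])
  have hpos : 0 < 1 + x/m := by linarith [(abs_le.1 habs).1]
  have h2 : exp (x/m - 2 * (x/m)^2) ≤ 1 + x/m := by
    rw [show x/m - 2 * (x/m)^2 = -(-(x/m) + 2 * (-(x/m))^2) by ring, Real.exp_neg]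
    rw [inv_le_comm₀ (exp_pos _) hpos]
    simpa using h1
  have h3 : exp (x - 2 * (x^2/m)) ≤ (1 + x/m)^m := by
    calc exp (x - 2 * (x^2/m)) = exp (x/m - 2 * (x/m)^2) ^ m := by
          rw [← Real.exp_nat_mul]; congr 1; field_simp
      _ ≤ _ := by gcongr
  have h4 : x^2/m ≤ 1 := by rw [div_le_one (by linarith)]; exact hx
  calc exp x ≤ exp (2 + (x - 2 * (x^2/m))) := Real.exp_le_exp.2 (by linarith)
    _ = exp 2 * exp (x - 2 * (x^2/m)) := Real.exp_add _ _
    _ ≤ _ := by gcongr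

lemma xsum_abs (a : ℕ → ℝ) (S : Finset ℕ) (ha : ∀ p ∈ S, 0 ≤ a p ∧ a p ≤ 4 / p) (f : ℕ → ℝ) (hf : ∀ p ∈ S, |f p| ≤ 1) :
    |∑ p ∈ S, a p * f p| ≤ 4 * ∑ p ∈ S, 1/(p:ℝ) := by
  rw [Finset.mul_sum]
  refine (Finset.abs_sum_le_sum_abs _ _).trans (Finset.sum_le_sum fun p hp => ?_)
  rw [abs_mul, abs_of_nonneg (ha p hp).1]
  calc a p * |f p| ≤ a p * 1 := mul_le_mul_of_nonneg_left (hf p hp) (ha p hp).1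
    _ ≤ _ := by rw [mul_one, mul_one_div]; exact (ha p hp).2

lemma card_Icc' (X : ℕ) : ∑ D ∈ Finset.Icc (-(X:ℤ)) X, (1:ℝ) = 2*X+1 := by
  simp
  have : ((X:ℤ) + 1 + X).toNat = 2 * X + 1 := by omega
  rw [this]; push_cast; ring

/-- the moment bound with explicit error -/
lemma moment_m (a : ℕ → ℝ) (ha : ∀ p : ℕ, p.Prime → 0 ≤ a p ∧ a p ≤ 4 / p) (X Y m : ℕ) (hm : 4 ≤ m) (hY : 1 ≤ Y)
    (hmY : (4 * psum Y)^2 ≤ m) :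
    ∑ D ∈ Finset.Icc (-(X:ℤ)) X, exp (∑ p ∈ Y.primesBelow, a p * chi D p) ≤
      exp 2 * ((2*X+1) * exp (8 * ∑' n : ℕ, 1 / (n:ℝ)^2) + (5 * Y)^m) := by
  set P := Y.primesBelow with hPdef
  have hP : ∀ p ∈ P, p.Prime := fun p hp => Nat.prime_of_mem_primesBelow hp
  have hm0 : (4:ℝ) ≤ m := by exact_mod_cast hm
  have hps : 0 ≤ psum Y := Finset.sum_nonneg fun _ _ => by positivity
  have ha' : ∀ p ∈ P, 0 ≤ a p ∧ a p ≤ 4 / p := fun p hp => ha p (hP p hp)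
  have hsgn : ∀ S ∈ P.powerset, ∀ p ∈ P, |sg S p| ≤ 1 := by
    intro S hS p hp
    rw [sg_prime P S hP (Finset.mem_powerset.1 hS) p hp]
    split_ifs <;> simp
  have hsq : ∀ f : ℕ → ℝ, (∀ p ∈ P, |f p| ≤ 1) → (∑ p ∈ P, a p * f p)^2 ≤ m := by
    intro f hf
    have := xsum_abs a P ha' f hf
    calc _ ≤ (4 * psum Y)^2 := by rw [sq_le_sq, abs_of_nonneg (show 0 ≤ 4 * psum Y by positivity)]; exact this
      _ ≤ m := hmY
  have h1 := moment_induct P (fun p hp => (hP p hp).ne_zero) (fun p => a p / m) (fun p hp => div_nonneg (ha' p hp).1 (by positivity)) X m 1 (by norm_num)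
  have hdiv : ∀ f : ℕ → ℝ, ∑ p ∈ P, a p / m * f p = (∑ p ∈ P, a p * f p) / m := by
    intro f; rw [Finset.sum_div]; exact Finset.sum_congr rfl fun p _ => by ring
  have hsg1 : ∀ S, sg S 1 = 1 := by intro S; simp [sg]
  simp only [hdiv, chi_one, hsg1, one_mul, Nat.cast_one] at h1
  have h2 : ∑ S ∈ P.powerset, (1 + (∑ p ∈ P, a p * sg S p) / m)^m ≤ ∑ S ∈ P.powerset, exp (∑ p ∈ P, a p * sg S p) := by
    refine Finset.sum_le_sum fun S hS => ?_
    set x := ∑ p ∈ P, a p * sg S p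
    have hx : x^2 ≤ m := hsq _ (hsgn S hS)
    have hxm : -1 ≤ x / m := by
      rw [le_div_iff₀ (by linarith)]; nlinarith
    calc (1 + x/m)^m ≤ (exp (x/m))^m := by
          apply pow_le_pow_left₀ (by linarith)
          linarith [Real.add_one_le_exp (x/m)]
      _ = exp x := by rw [← Real.exp_nat_mul]; congr 1; field_simp
  have h3 := sg_exp_sum P hP a
  have h4 : ∑ p ∈ P, a p ^ 2 / 2 ≤ 8 * ∑' n : ℕ, 1 / (n:ℝ)^2 := by
    refine le_trans ?_ (mul_le_mul_of_nonneg_left (sum_prime_sq_le P) (by norm_num))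
    rw [Finset.mul_sum]
    refine Finset.sum_le_sum fun p hp => ?_
    have := pow_le_pow_left₀ (ha' p hp).1 (ha' p hp).2 2
    rw [div_pow] at this
    calc a p ^ 2 / 2 ≤ 4^2 / (p:ℝ)^2 / 2 := by gcongr
      _ = _ := by ring
  have h5 : ∑ p ∈ P, a p * p ≤ 4 * Y := by
    calc ∑ p ∈ P, a p * p ≤ ∑ p ∈ P, (4:ℝ) := by
          refine Finset.sum_le_sum fun p hp => ?_
          have : (0:ℝ) < p := by exact_mod_cast (hP p hp).pos
          have := (ha' p hp).2
          rwa [le_div_iff₀ (by assumption)] at this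
      _ ≤ 4 * Y := by
          rw [Finset.sum_const, nsmul_eq_mul, mul_comm]
          have : P.card ≤ Y := by
            rw [hPdef, Nat.primesBelow]
            exact (Finset.card_filter_le _ _).trans (by simp)
          have : (P.card:ℝ) ≤ Y := by exact_mod_cast this
          linarith
  have h5' : 0 ≤ ∑ p ∈ P, a p * p := Finset.sum_nonneg fun p hp => mul_nonneg (ha' p hp).1 (by positivity)
  have hY' : (1:ℝ) ≤ Y := by exact_mod_cast hY
  have h6 : (1 + (∑ p ∈ P, a p * p) / m)^m ≤ (5 * (Y:ℝ))^m := by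
    apply pow_le_pow_left₀ (by positivity)
    have : (∑ p ∈ P, a p * p) / m ≤ 4 * Y := by
      rw [div_le_iff₀ (by linarith)]; nlinarith
    linarith
  calc ∑ D ∈ Finset.Icc (-(X:ℤ)) X, exp (∑ p ∈ P, a p * chi D p)
      ≤ ∑ D ∈ Finset.Icc (-(X:ℤ)) X, exp 2 * (1 + (∑ p ∈ P, a p * chi D p)/m)^m :=
        Finset.sum_le_sum fun D _ => exp_le_pow _ m hm (hsq _ fun p _ => chi_abs D p)
    _ = exp 2 * ∑ D ∈ Finset.Icc (-(X:ℤ)) X, (1 + (∑ p ∈ P, a p * chi D p)/m)^m := by rw [Finset.mul_sum]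
    _ ≤ _ := by
      refine mul_le_mul_of_nonneg_left (h1.trans ?_) (exp_pos _).le
      refine add_le_add ?_ h6
      rw [mul_assoc]
      refine mul_le_mul_of_nonneg_left ?_ (by positivity)
      refine le_trans ?_ (h3.trans (Real.exp_le_exp.2 h4))
      exact mul_le_mul_of_nonneg_left h2 (by positivity)

lemma lemmaD : ∃ C : ℝ, 0 < C ∧ ∀ (a : ℕ → ℝ), (∀ p : ℕ, p.Prime → 0 ≤ a p ∧ a p ≤ 4 / p) → ∀ X Y : ℕ, 2 ≤ X → 2 ≤ Y →
    log Y ≤ (log X)^((11:ℝ)/14) → ∑ D ∈ Finset.Icc (-(X:ℤ)) X, exp (∑ p ∈ Y.primesBelow, a p * chi D p) ≤ C * X := by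
  obtain ⟨C2, hC2, h2⟩ := mertens_upper
  set K : ℝ := 16 * (28^2 * C2^((1:ℝ)/14)) + 5 with hK
  have hK0 : 5 ≤ K := by rw [hK]; have : 0 < C2^((1:ℝ)/14) := rpow_pos_of_pos hC2 _; nlinarith
  set L0 : ℝ := (3*K)^7 with hL0
  have hL01 : 1 ≤ L0 := one_le_pow₀ (by linarith)
  refine ⟨3 * (C2 * L0)^4 + exp 2 * (3 * exp (8 * ∑' n : ℕ, 1 / (n:ℝ)^2) + 1), by positivity, fun a ha X Y hX hY hYX => ?_⟩
  have hX2 : (2:ℝ) ≤ X := by exact_mod_cast hX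
  have hY2 : (2:ℝ) ≤ Y := by exact_mod_cast hY
  have hl2 : 1/2 < log 2 := by linarith [Real.log_two_gt_d9]
  have hlY : log 2 ≤ log Y := Real.log_le_log (by norm_num) hY2
  have hlX : log 2 ≤ log X := Real.log_le_log (by norm_num) hX2
  have hps : 0 ≤ psum Y := Finset.sum_nonneg fun _ _ => by positivity
  have hT : 0 < exp (8 * ∑' n : ℕ, 1 / (n:ℝ)^2) := exp_pos _
  set L := log X with hL
  have hpsY := h2 Y hY
  rcases lt_or_ge L L0 with hlt | hge
  · have hb : ∀ D ∈ Finset.Icc (-(X:ℤ)) X, exp (∑ p ∈ Y.primesBelow, a p * chi D p) ≤ (C2 * L0)^4 * 1 := by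
      intro D _
      have e1 := (abs_le.1 (xsum_abs a Y.primesBelow (fun p hp => ha p (Nat.prime_of_mem_primesBelow hp)) (chi D) (fun p _ => chi_abs D p))).2
      have e2 : log Y ≤ L0 := by
        calc log Y ≤ L^((11:ℝ)/14) := hYX
          _ ≤ L0^((11:ℝ)/14) := by apply Real.rpow_le_rpow (by linarith) hlt.le (by norm_num)
          _ ≤ L0^(1:ℝ) := Real.rpow_le_rpow_of_exponent_le hL01 (by norm_num)
          _ = L0 := Real.rpow_one _
      calc _ ≤ exp (4 * psum Y) := Real.exp_le_exp.2 e1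
        _ = exp (psum Y) ^ 4 := by rw [← Real.exp_nat_mul]; norm_num
        _ ≤ (C2 * log Y)^4 := by gcongr
        _ ≤ (C2 * L0)^4 := by gcongr
        _ = _ := by ring
    refine (Finset.sum_le_sum hb).trans ?_
    rw [← Finset.mul_sum, card_Icc']
    have p1 : 0 < (C2 * L0)^4 := by positivity
    have p2 : 0 < exp 2 * (3 * exp (8 * ∑' n : ℕ, 1 / (n:ℝ)^2) + 1) := by positivity
    nlinarith [mul_pos p2 (show (0:ℝ) < X by linarith), mul_nonneg p1.le (show (0:ℝ) ≤ X - 1 by linarith)]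
  · have hL1 : 1 ≤ L := hL01.trans hge
    set m := ⌈(4 * psum Y)^2⌉₊ + 4 with hm
    have hm1 : (4 * psum Y)^2 ≤ m := by
      rw [hm]; push_cast; linarith [Nat.le_ceil ((4 * psum Y)^2)]
    have hm2 : (m:ℝ) ≤ (4 * psum Y)^2 + 5 := by
      rw [hm]; push_cast; linarith [Nat.ceil_lt_add_one (show 0 ≤ (4 * psum Y)^2 by positivity)]
    have hLr : L^((11:ℝ)/14) ≤ L := by
      calc _ ≤ L^(1:ℝ) := Real.rpow_le_rpow_of_exponent_le hL1 (by norm_num)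
        _ = L := Real.rpow_one _
    have hps2 : psum Y ≤ 28 * (C2 * L)^((1:ℝ)/28) := by
      have : psum Y ≤ log (C2 * L) := by
        rw [Real.le_log_iff_exp_le (by positivity)]
        exact hpsY.trans (by gcongr; linarith)
      have h3 := Real.log_le_rpow_div (show 0 ≤ C2 * L by positivity) (show (0:ℝ) < 1/28 by norm_num)
      calc _ ≤ _ := this
        _ ≤ _ := h3
        _ = _ := by ring
    have hL14 : 1 ≤ L^((1:ℝ)/14) := Real.one_le_rpow hL1 (by norm_num)
    have hmK : (m:ℝ) ≤ K * L^((1:ℝ)/14) := by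
      have : psum Y ^ 2 ≤ 28^2 * (C2^((1:ℝ)/14) * L^((1:ℝ)/14)) := by
        calc psum Y ^ 2 ≤ (28 * (C2 * L)^((1:ℝ)/28))^2 := by gcongr
          _ = 28^2 * ((C2 * L)^((1:ℝ)/28))^2 := by ring
          _ = _ := by
            rw [← Real.rpow_natCast ((C2 * L)^((1:ℝ)/28)), ← Real.rpow_mul (by positivity), Real.mul_rpow hC2.le (by linarith)]
            norm_num
      rw [hK]; nlinarith
    have hYm : (5 * (Y:ℝ))^m ≤ X := by
      have hL11 : 1 ≤ L^((11:ℝ)/14) := Real.one_le_rpow hL1 (by norm_num)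
      have h5 : log 5 ≤ 2 := by
        rw [Real.log_le_iff_le_exp (by norm_num)]
        have := Real.quadratic_le_exp_of_nonneg (show (0:ℝ) ≤ 2 by norm_num)
        linarith
      have hlog : m * log (5 * (Y:ℝ)) ≤ L := by
        rw [Real.log_mul (by norm_num) (by positivity)]
        calc m * (log 5 + log Y) ≤ (K * L^((1:ℝ)/14)) * (3 * L^((11:ℝ)/14)) := by
              gcongr; linarith
          _ = 3 * K * L^((12:ℝ)/14) := by
              rw [show (12:ℝ)/14 = 1/14 + 11/14 by norm_num, Real.rpow_add (by linarith)]; ring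
          _ ≤ L^((1:ℝ)/7) * L^((12:ℝ)/14) := by
              gcongr
              calc 3 * K = L0^((1:ℝ)/7) := by
                    rw [hL0, ← Real.rpow_natCast, ← Real.rpow_mul (by positivity)]; norm_num
                _ ≤ _ := by gcongr
          _ = L := by
              rw [← Real.rpow_add (by linarith)]; norm_num
      rw [← Real.log_le_log_iff (by positivity) (by linarith), Real.log_pow]
      exact hlog
    refine (moment_m a ha X Y m (by omega) (by omega) hm1).trans ?_
    have e0 : 0 < exp 2 := exp_pos _
    have : 0 ≤ 3 * (C2 * L0)^4 * X := by positivity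
    calc _ ≤ exp 2 * (3 * X * exp (8 * ∑' n : ℕ, 1 / (n:ℝ)^2) + X) := by
          gcongr; linarith
      _ ≤ 3 * (C2 * L0)^4 * X + exp 2 * (3 * X * exp (8 * ∑' n : ℕ, 1 / (n:ℝ)^2) + X) := by linarith
      _ = _ := by ring

end

section

open NumberField

section euler
variable {α : Type*} [CommMonoidWithZero α] [UniqueFactorizationMonoid α] 

open scoped Classical in
lemma euler_finite [Subsingleton αˣ] (f : α → ℝ) (hf0 : ∀ x, 0 ≤ f x) (hf1 : f 1 = 1) (hmul : ∀ x y, f (x*y) = f x * f y)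
    (T : Finset α) : (∀ P ∈ T, Prime P ∧ f P < 1) →
    ∀ F : Finset α, (∀ I ∈ F, I ≠ 0 ∧ ∀ P, Prime P → P ∣ I → P ∈ T) →
      ∑ I ∈ F, f I ≤ ∏ P ∈ T, (1 - f P)⁻¹ := by
  induction T using Finset.induction_on with
  | empty =>
    intro _ F hF
    have : F ⊆ {1} := by
      intro I hI
      rw [Finset.mem_singleton]
      by_contra h1
      have hu : ¬ IsUnit I := by rw [isUnit_iff_eq_one]; exact h1
      obtain ⟨P, hP, hPI⟩ := WfDvdMonoid.exists_irreducible_factor hu (hF I hI).1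
      exact absurd ((hF I hI).2 P hP.prime hPI) (by simp)
    calc ∑ I ∈ F, f I ≤ ∑ I ∈ {1}, f I := Finset.sum_le_sum_of_subset_of_nonneg this fun x _ _ => hf0 x
      _ = _ := by simp [hf1]
  | insert P T hPT ih =>
    intro hT F hF
    have hP := (hT P (Finset.mem_insert_self _ _)).1
    have hfP := (hT P (Finset.mem_insert_self _ _)).2
    have hpow : ∀ k, f (P^k) = f P ^ k := by
      intro k; induction k with
      | zero => simp [hf1]
      | succ k ih => rw [pow_succ, hmul, ih, pow_succ]
    have hdec : ∀ I : α, ∃ kJ : ℕ × α, I ≠ 0 → I = P^kJ.1 * kJ.2 ∧ ¬ P ∣ kJ.2 := by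
      intro I
      by_cases hI : I = 0
      · exact ⟨(0,0), fun h => absurd hI h⟩
      · obtain ⟨c, hc⟩ := (FiniteMultiplicity.of_prime_left hP hI).exists_eq_pow_mul_and_not_dvd
        exact ⟨(_, c), fun _ => hc⟩
    choose g hg using hdec
    set G := F.image (fun I => (g I).2)
    set K := F.sup (fun I => (g I).1)
    have hsub : F.image g ⊆ Finset.range (K+1) ×ˢ G := by
      intro x hx
      rw [Finset.mem_image] at hx
      obtain ⟨I, hI, rfl⟩ := hx
      rw [Finset.mem_product, Finset.mem_range]
      refine ⟨Nat.lt_succ_of_le (Finset.le_sup (f := fun I => (g I).1) hI), Finset.mem_image_of_mem _ hI⟩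
    have hinj : Set.InjOn g F := by
      intro I hI J hJ h
      rw [(hg I (hF I hI).1).1, (hg J (hF J hJ).1).1, h]
    calc ∑ I ∈ F, f I = ∑ I ∈ F, f P ^ (g I).1 * f (g I).2 := by
          refine Finset.sum_congr rfl fun I hI => ?_
          conv_lhs => rw [(hg I (hF I hI).1).1, hmul, hpow]
      _ = ∑ x ∈ F.image g, f P ^ x.1 * f x.2 := by rw [Finset.sum_image hinj]
      _ ≤ ∑ x ∈ Finset.range (K+1) ×ˢ G, f P ^ x.1 * f x.2 :=
          Finset.sum_le_sum_of_subset_of_nonneg hsub fun x _ _ => mul_nonneg (pow_nonneg (hf0 _) _) (hf0 _)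
      _ = (∑ k ∈ Finset.range (K+1), f P ^ k) * ∑ J ∈ G, f J := by
          rw [Finset.sum_product, Finset.sum_mul_sum]
      _ ≤ (1 - f P)⁻¹ * ∏ Q ∈ T, (1 - f Q)⁻¹ := by
          refine mul_le_mul ?_ ?_ (Finset.sum_nonneg fun x _ => hf0 x) (inv_nonneg.2 (by linarith))
          · rw [← tsum_geometric_of_lt_one (hf0 P) hfP]
            exact (summable_geometric_of_lt_one (hf0 P) hfP).sum_le_tsum _ (fun _ _ => pow_nonneg (hf0 _) _)
          · refine ih (fun Q hQ => hT Q (Finset.mem_insert_of_mem hQ)) G ?_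
            intro J hJ
            rw [Finset.mem_image] at hJ
            obtain ⟨I, hI, rfl⟩ := hJ
            obtain ⟨h1, h2⟩ := hg I (hF I hI).1
            refine ⟨?_, fun Q hQ hQJ => ?_⟩
            · intro h; rw [h] at h2; exact h2 (dvd_zero _)
            · have := (hF I hI).2 Q hQ (by rw [h1]; exact hQJ.mul_left _)
              rw [Finset.mem_insert] at this
              rcases this with rfl | h
              · exact absurd hQJ h2
              · exact h
      _ = _ := by rw [Finset.prod_insert hPT]
end euler

section loc
variable {M : Type*} [Field M] [NumberField M]

lemma local_count (h4 : Module.finrank ℚ M = 4) (p : ℕ) (hp : p.Prime) (T : Finset (Ideal (𝓞 M))) (e f : ℕ)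
    (hT : ∀ P ∈ T, Prime P ∧ P ^ e ∣ Ideal.span {(p : 𝓞 M)} ∧ p ^ f ∣ Ideal.absNorm P) : e * f * T.card ≤ 4 := by
  have h1 : ∏ P ∈ T, P ^ e ∣ Ideal.span {(p : 𝓞 M)} := by
    apply Finset.prod_dvd_of_isRelPrime
    · intro P hP Q hQ hPQ
      apply IsRelPrime.pow
      rw [(hT P hP).1.irreducible.isRelPrime_iff_not_dvd]
      intro h
      exact hPQ (associated_iff_eq.1 ((hT P hP).1.associated_of_dvd (hT Q hQ).1 h))
    · intro P hP; exact (hT P hP).2.1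
  have h2 : Ideal.absNorm (Ideal.span {(p : 𝓞 M)}) = p ^ 4 := by
    rw [Ideal.absNorm_span_singleton]
    have := Algebra.norm_algebraMap (R := ℤ) (S := 𝓞 M) (p:ℤ)
    rw [RingOfIntegers.rank, h4] at this
    simp only [algebraMap_int_eq, eq_intCast, Int.cast_natCast] at this
    rw [this]; simp [Int.natAbs_pow]
  have h3 := map_dvd Ideal.absNorm h1
  rw [h2, map_prod] at h3
  have h4 : ∏ P ∈ T, (p^f)^e ∣ ∏ P ∈ T, Ideal.absNorm (P^e) := by
    apply Finset.prod_dvd_prod_of_dvd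
    intro P hP
    rw [map_pow]
    exact pow_dvd_pow_of_dvd (hT P hP).2.2 e
  have h5 := h4.trans h3
  rw [Finset.prod_const, ← pow_mul, ← pow_mul] at h5
  have := (Nat.pow_dvd_pow_iff_le_right hp.one_lt).1 h5
  rw [mul_comm e f, mul_assoc]; exact this

lemma mem_int_iff (P : Ideal (𝓞 M)) (hP : Prime P) (p : ℕ) (hp : p.Prime) (hpP : (p : 𝓞 M) ∈ P) (n : ℤ) (hn : (n : 𝓞 M) ∈ P) : (p:ℤ) ∣ n := by
  by_contra h
  have hc : IsCoprime (p:ℤ) n := (Nat.prime_iff_prime_int.1 hp).irreducible.coprime_iff_not_dvd.2 h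
  obtain ⟨a, b, hab⟩ := hc
  have : (1 : 𝓞 M) ∈ P := by
    have : (1 : 𝓞 M) = (a:𝓞 M) * (p : 𝓞 M) + b * n := by
      exact_mod_cast congrArg (Int.cast : ℤ → 𝓞 M) hab.symm
    rw [this]
    exact P.add_mem (P.mul_mem_left _ hpP) (P.mul_mem_left _ hn)
  exact (Ideal.isPrime_of_prime hP).ne_top ((Ideal.eq_top_iff_one P).2 this)

lemma absNorm_dvd (h4 : Module.finrank ℚ M = 4) (P : Ideal (𝓞 M)) (p : ℕ) (hpP : (p : 𝓞 M) ∈ P) : Ideal.absNorm P ∣ p^4 := by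
  have h2 : Ideal.absNorm (Ideal.span {(p : 𝓞 M)}) = p ^ 4 := by
    rw [Ideal.absNorm_span_singleton]
    have := Algebra.norm_algebraMap (R := ℤ) (S := 𝓞 M) (p:ℤ)
    rw [RingOfIntegers.rank, h4] at this
    simp only [algebraMap_int_eq, eq_intCast, Int.cast_natCast] at this
    rw [this]; simp [Int.natAbs_pow]
  rw [← h2]
  exact map_dvd Ideal.absNorm (Ideal.dvd_span_singleton.2 hpP)

/-- degree one prime: squares -/
lemma isSquare_of_degree_one (P : Ideal (𝓞 M)) (p : ℕ) (hp : p.Prime) (hP : Prime P) (hpP : (p : 𝓞 M) ∈ P)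
    (hN : Ideal.absNorm P = p) (c : 𝓞 M) (a : ℤ) (hc : c^2 = (a : 𝓞 M)) : IsSquare (a : ZMod p) := by
  have hfin : Finite (𝓞 M ⧸ P) := by
    apply Nat.finite_of_card_ne_zero
    rw [Ideal.absNorm_apply, Submodule.cardQuot_apply] at hN
    rw [hN]; exact hp.ne_zero
  have : Fintype (𝓞 M ⧸ P) := Fintype.ofFinite _
  have hcard : Fintype.card (𝓞 M ⧸ P) = p := by
    rw [← Nat.card_eq_fintype_card]
    rwa [Ideal.absNorm_apply, Submodule.cardQuot_apply] at hN
  have φ := ZMod.ringEquivOfPrime (𝓞 M ⧸ P) hp hcard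
  refine ⟨φ.symm (Ideal.Quotient.mk P c), ?_⟩
  rw [← map_mul, ← map_mul, ← pow_two, hc]
  simp
end loc

end

section

open NumberField

section loc
variable {M : Type*} [Field M] [NumberField M]

noncomputable def EP (d Δ : ℤ) (p : ℕ) (x : ℝ) : ℝ :=
  (1 - x)⁻¹ * (1 - chi d p * x)⁻¹ * (1 - chi Δ p * x)⁻¹ * (1 - chi (d*Δ) p * x)⁻¹

lemma loc_prod_le (p : ℕ) (hp : p.Prime) (σ : ℝ) (hσ : 1 < σ) (T : Finset (Ideal (𝓞 M))) (f k : ℕ) (hf : 1 ≤ f) (hk : T.card ≤ k)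
    (hT : ∀ P ∈ T, Prime P ∧ p ^ f ∣ Ideal.absNorm P) :
    ∏ P ∈ T, (1 - (Ideal.absNorm P : ℝ)^(-σ))⁻¹ ≤ ((1 - ((p:ℝ)^(-σ))^f)⁻¹)^k := by
  have hp2 : (1:ℝ) < p := by exact_mod_cast hp.one_lt
  set x := (p:ℝ)^(-σ) with hx
  have hx0 : 0 < x := Real.rpow_pos_of_pos (by linarith) _
  have hx1 : x < 1 := Real.rpow_lt_one_of_one_lt_of_neg hp2 (by linarith)
  have hxf : x^f < 1 := pow_lt_one₀ hx0.le hx1 (by omega)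
  have h1 : ∀ P ∈ T, 0 ≤ (1 - (Ideal.absNorm P : ℝ)^(-σ))⁻¹ ∧ (1 - (Ideal.absNorm P : ℝ)^(-σ))⁻¹ ≤ (1 - x^f)⁻¹ := by
    intro P hP
    have hN0 : Ideal.absNorm P ≠ 0 := by
      rw [Ne, Ideal.absNorm_eq_zero_iff]; exact (hT P hP).1.ne_zero
    have hle : (p^f : ℝ) ≤ Ideal.absNorm P := by
      exact_mod_cast Nat.le_of_dvd (Nat.pos_of_ne_zero hN0) (hT P hP).2
    have hle2 : (Ideal.absNorm P : ℝ)^(-σ) ≤ x^f := by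
      calc (Ideal.absNorm P : ℝ)^(-σ) ≤ ((p:ℝ)^f)^(-σ) := Real.rpow_le_rpow_of_nonpos (by positivity) hle (by linarith)
        _ = x^f := by
          rw [hx, ← Real.rpow_natCast, ← Real.rpow_natCast, ← Real.rpow_mul (by linarith), ← Real.rpow_mul (by linarith), mul_comm]
    exact ⟨inv_nonneg.2 (by linarith), inv_anti₀ (by linarith) (by linarith)⟩
  have hge : 1 ≤ (1 - x^f)⁻¹ := by
    rw [one_le_inv₀ (by linarith)]; linarith [pow_pos hx0 f]
  calc _ ≤ ∏ P ∈ T, (1 - x^f)⁻¹ := Finset.prod_le_prod (fun P hP => (h1 P hP).1) (fun P hP => (h1 P hP).2)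
    _ = ((1 - x^f)⁻¹)^T.card := Finset.prod_const _
    _ ≤ _ := pow_le_pow_right₀ hge hk

lemma factor_bounds (e x : ℝ) (hx0 : 0 < x) (hx : x ≤ 1/2) (he : |e| ≤ 1) : 2/3 ≤ (1 - e * x)⁻¹ := by
  have := abs_le.1 he
  rw [le_inv_comm₀ (by norm_num) (by nlinarith)]
  norm_num; nlinarith

lemma local_bad (h4 : Module.finrank ℚ M = 4) (d Δ : ℤ) (p : ℕ) (hp : p.Prime) (σ : ℝ) (hσ : 1 < σ) (T : Finset (Ideal (𝓞 M)))
    (hx : (p:ℝ)^(-σ) ≤ 1/2)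
    (hT : ∀ P ∈ T, Prime P ∧ (p : 𝓞 M) ∈ P) (hpN : ∀ P ∈ T, p ∣ Ideal.absNorm P) :
    ∏ P ∈ T, (1 - (Ideal.absNorm P : ℝ)^(-σ))⁻¹ ≤ 54 * EP d Δ p ((p:ℝ)^(-σ)) := by
  have hc := local_count h4 p hp T 1 1 (fun P hP => ⟨(hT P hP).1, by simpa using (hT P hP).2, by simpa using hpN P hP⟩)
  have h1 := loc_prod_le p hp σ hσ T 1 4 le_rfl (by omega) (fun P hP => ⟨(hT P hP).1, by simpa using hpN P hP⟩)
  refine h1.trans ?_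
  set x := (p:ℝ)^(-σ)
  have hx0 : 0 < x := Real.rpow_pos_of_pos (by exact_mod_cast hp.pos) _
  have f1 := factor_bounds _ x hx0 hx (chi_abs d p)
  have f2 := factor_bounds _ x hx0 hx (chi_abs Δ p)
  have f3 := factor_bounds _ x hx0 hx (chi_abs (d*Δ) p)
  have f0 : (1 - x)⁻¹ ≤ 2 := by
    rw [inv_le_comm₀ (by linarith) (by norm_num)]; linarith
  have f00 : 0 < (1 - x)⁻¹ := inv_pos.2 (by linarith)
  rw [pow_one]
  unfold EP
  calc ((1-x)⁻¹)^4 = (1-x)⁻¹ * ((1-x)⁻¹)^3 := by ring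
    _ ≤ (1-x)⁻¹ * 2^3 := by gcongr
    _ ≤ (1-x)⁻¹ * (54 * ((2/3) * (2/3) * (2/3))) := by gcongr; norm_num
    _ ≤ (1-x)⁻¹ * (54 * ((1 - chi d p * x)⁻¹ * (1 - chi Δ p * x)⁻¹ * (1 - chi (d*Δ) p * x)⁻¹)) := by gcongr
    _ = _ := by ring

lemma chi_eq_one_of_square (p : ℕ) (hp : p.Prime) (hp2 : p ≠ 2) (a : ℤ) (ha : ¬ (p:ℤ) ∣ a) (hs : IsSquare (a : ZMod p)) : chi a p = 1 := by
  have : Fact p.Prime := ⟨hp⟩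
  have h0 : (a : ZMod p) ≠ 0 := by rwa [Ne, ZMod.intCast_zmod_eq_zero_iff_dvd]
  have : legendreSym p a = 1 := (legendreSym.eq_one_iff p h0).2 hs
  rw [chi, if_pos (hp.odd_of_ne_two hp2), ← jacobiSym.legendreSym.to_jacobiSym, this]; norm_num
lemma chi_eq_zero_of_dvd (p : ℕ) (hp : p.Prime) (hp2 : p ≠ 2) (a : ℤ) (ha : (p:ℤ) ∣ a) : chi a p = 0 := by
  have : Fact p.Prime := ⟨hp⟩
  rw [chi, if_pos (hp.odd_of_ne_two hp2), ← jacobiSym.legendreSym.to_jacobiSym]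
  have h0 : (a : ZMod p) = 0 := by rwa [ZMod.intCast_zmod_eq_zero_iff_dvd]
  rw [(legendreSym.eq_zero_iff p a).2 h0]; norm_num
lemma chi_pm_of_not_dvd (p : ℕ) (hp : p.Prime) (hp2 : p ≠ 2) (a : ℤ) (ha : ¬ (p:ℤ) ∣ a) : chi a p = 1 ∨ chi a p = -1 := by
  have : Fact p.Prime := ⟨hp⟩
  rw [chi, if_pos (hp.odd_of_ne_two hp2), ← jacobiSym.legendreSym.to_jacobiSym]
  have h0 : (a : ZMod p) ≠ 0 := by rwa [Ne, ZMod.intCast_zmod_eq_zero_iff_dvd]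
  rcases legendreSym.eq_one_or_neg_one p h0 with h | h <;> simp [h]

lemma sq_dvd_of_ramified (P : Ideal (𝓞 M)) (hP : Prime P) (p : ℕ) (hp : p.Prime) (hpP : (p : 𝓞 M) ∈ P) (Δ : ℤ) (s : 𝓞 M) (hs : s^2 = (Δ : 𝓞 M))
    (hd : (p:ℤ) ∣ Δ) (hd2 : ¬ (p:ℤ)^2 ∣ Δ) : P^2 ∣ Ideal.span {(p : 𝓞 M)} := by
  obtain ⟨u, rfl⟩ := hd
  have hu : ¬ (p:ℤ) ∣ u := by
    rintro ⟨v, rfl⟩; exact hd2 ⟨v, by ring⟩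
  have hsP : s ∈ P := by
    apply (Ideal.isPrime_of_prime hP).mem_of_pow_mem 2
    rw [hs]; push_cast; exact P.mul_mem_right _ hpP
  have h1 : P^2 ∣ Ideal.span {(p : 𝓞 M)} * Ideal.span {(u : 𝓞 M)} := by
    rw [Ideal.span_singleton_mul_span_singleton]
    have : (p : 𝓞 M) * u = s^2 := by rw [hs]; push_cast; rfl
    rw [this, ← Ideal.span_singleton_pow]
    exact pow_dvd_pow_of_dvd (Ideal.dvd_span_singleton.2 hsP) 2
  refine hP.pow_dvd_of_dvd_mul_right 2 ?_ h1
  rw [Ideal.dvd_span_singleton]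
  intro h
  exact hu (mem_int_iff P hP p hp hpP u h)

lemma local_good (h4 : Module.finrank ℚ M = 4) (d Δ : ℤ) (c s : 𝓞 M) (hc : c^2 = (d : 𝓞 M)) (hs : s^2 = (Δ : 𝓞 M))
    (p : ℕ) (hp : p.Prime) (hp2 : p ≠ 2) (hpd : ¬ (p:ℤ) ∣ d) (hpΔ : ¬ (p:ℤ)^2 ∣ Δ)
    (σ : ℝ) (hσ : 1 < σ) (T : Finset (Ideal (𝓞 M)))
    (hx : (p:ℝ)^(-σ) ≤ 1/2)
    (hT : ∀ P ∈ T, Prime P ∧ (p : 𝓞 M) ∈ P) :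
    ∏ P ∈ T, (1 - (Ideal.absNorm P : ℝ)^(-σ))⁻¹ ≤ EP d Δ p ((p:ℝ)^(-σ)) := by
  have hN1 : ∀ P ∈ T, p ∣ Ideal.absNorm P := by
    intro P hP
    obtain ⟨i, hi, hN⟩ := (Nat.dvd_prime_pow hp).1 (absNorm_dvd h4 P p (hT P hP).2)
    rcases Nat.eq_zero_or_pos i with rfl | hi0
    · rw [pow_zero, Ideal.absNorm_eq_one_iff] at hN
      exact absurd hN (Ideal.isPrime_of_prime (hT P hP).1).ne_top
    · rw [hN]; exact dvd_pow_self p (by omega)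
  have hN2 : ∀ P ∈ T, Ideal.absNorm P ≠ p → p^2 ∣ Ideal.absNorm P := by
    intro P hP hne
    obtain ⟨i, hi, hN⟩ := (Nat.dvd_prime_pow hp).1 (absNorm_dvd h4 P p (hT P hP).2)
    rcases Nat.eq_zero_or_pos i with rfl | hi0
    · rw [pow_zero, Ideal.absNorm_eq_one_iff] at hN
      exact absurd hN (Ideal.isPrime_of_prime (hT P hP).1).ne_top
    · have : i ≠ 1 := by rintro rfl; exact hne (by simpa using hN)
      rw [hN]; exact pow_dvd_pow p (by omega)
  have hspan : ∀ P ∈ T, P^1 ∣ Ideal.span {(p : 𝓞 M)} := fun P hP => by simpa using (hT P hP).2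
  have hx0 : 0 < (p:ℝ)^(-σ) := Real.rpow_pos_of_pos (by exact_mod_cast hp.pos) _
  have hlp := fun f k hf hk hT => loc_prod_le (M := M) p hp σ hσ T f k hf hk hT
  set x := (p:ℝ)^(-σ) with hxdef
  have hx1 : 0 < 1 - x := by linarith
  have hx1' : 0 < 1 + x := by linarith
  have hsqf : (1 - x^2)⁻¹ = (1-x)⁻¹ * (1+x)⁻¹ := by rw [← mul_inv]; congr 1; ring
  have hmono : (1+x)⁻¹ ≤ (1-x)⁻¹ := inv_anti₀ hx1 (by linarith)
  have hA : 0 < (1-x)⁻¹ := inv_pos.2 hx1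
  have hB : 0 < (1+x)⁻¹ := inv_pos.2 hx1'
  unfold EP
  rw [chi_mul_left]
  by_cases hpD : (p:ℤ) ∣ Δ
  · have hχ := chi_eq_zero_of_dvd p hp hp2 Δ hpD
    rw [hχ]
    have hP2 : ∀ P ∈ T, P^2 ∣ Ideal.span {(p : 𝓞 M)} := fun P hP => sq_dvd_of_ramified P (hT P hP).1 p hp (hT P hP).2 Δ s hs hpD hpΔ
    by_cases h1 : ∃ P ∈ T, Ideal.absNorm P = p
    · obtain ⟨P, hP, hPN⟩ := h1
      have hχd := chi_eq_one_of_square p hp hp2 d hpd (isSquare_of_degree_one P p hp (hT P hP).1 (hT P hP).2 hPN c d hc)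
      rw [hχd]
      have hc := local_count h4 p hp T 2 1 (fun P hP => ⟨(hT P hP).1, hP2 P hP, by simpa using hN1 P hP⟩)
      refine (hlp 1 2 le_rfl (by omega) (fun P hP => ⟨(hT P hP).1, by simpa using hN1 P hP⟩)).trans (le_of_eq ?_)
      rw [pow_one, pow_two]; simp
    · push Not at h1
      have hN2' := fun P hP => hN2 P hP (h1 P hP)
      have hc := local_count h4 p hp T 2 2 (fun P hP => ⟨(hT P hP).1, hP2 P hP, hN2' P hP⟩)
      refine (hlp 2 1 (by norm_num) (by omega) (fun P hP => ⟨(hT P hP).1, hN2' P hP⟩)).trans ?_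
      rw [pow_one, hsqf]
      rcases chi_pm_of_not_dvd p hp hp2 d hpd with h | h <;> rw [h]
      · simp only [one_mul, zero_mul, mul_zero, sub_zero, inv_one, mul_one]; gcongr
      · simp
  · by_cases h1 : ∃ P ∈ T, Ideal.absNorm P = p
    · obtain ⟨P, hP, hPN⟩ := h1
      have hχd := chi_eq_one_of_square p hp hp2 d hpd (isSquare_of_degree_one P p hp (hT P hP).1 (hT P hP).2 hPN c d hc)
      have hχΔ := chi_eq_one_of_square p hp hp2 Δ hpD (isSquare_of_degree_one P p hp (hT P hP).1 (hT P hP).2 hPN s Δ hs)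
      rw [hχd, hχΔ]
      have hc := local_count h4 p hp T 1 1 (fun P hP => ⟨(hT P hP).1, hspan P hP, by simpa using hN1 P hP⟩)
      refine (hlp 1 4 le_rfl (by omega) (fun P hP => ⟨(hT P hP).1, by simpa using hN1 P hP⟩)).trans (le_of_eq ?_)
      simp only [one_mul, mul_one, pow_one]; ring
    · push Not at h1
      have hN2' := fun P hP => hN2 P hP (h1 P hP)
      have hc := local_count h4 p hp T 1 2 (fun P hP => ⟨(hT P hP).1, hspan P hP, hN2' P hP⟩)
      refine (hlp 2 2 (by norm_num) (by omega) (fun P hP => ⟨(hT P hP).1, hN2' P hP⟩)).trans ?_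
      rw [hsqf]
      have key : ((1-x)⁻¹ * (1+x)⁻¹)^2 ≤ (1-x)⁻¹ * (1-x)⁻¹ * (1-x)⁻¹ * (1-x)⁻¹ := by
        calc _ ≤ ((1-x)⁻¹ * (1-x)⁻¹)^2 := by gcongr
          _ = _ := by ring
      rcases chi_pm_of_not_dvd p hp hp2 d hpd with h | h <;> rcases chi_pm_of_not_dvd p hp hp2 Δ hpD with h' | h' <;> rw [h, h']
      · simpa using key
      all_goals
        refine le_of_eq ?_
        simp only [one_mul, mul_one, neg_mul, mul_neg, neg_neg, sub_neg_eq_add]; ring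
end loc

end

section

open NumberField

lemma rpow_half (p : ℕ) (hp : p.Prime) (σ : ℝ) (hσ : 1 < σ) : (p:ℝ)^(-σ) ≤ 1/2 := by
  have hp2 : (2:ℝ) ≤ p := by exact_mod_cast hp.two_le
  calc (p:ℝ)^(-σ) ≤ (p:ℝ)^(-1:ℝ) := Real.rpow_le_rpow_of_exponent_le (by linarith) (by linarith)
    _ = 1 / p := by rw [Real.rpow_neg_one, one_div]
    _ ≤ 1/2 := one_div_le_one_div_of_le (by norm_num) hp2

lemma EP_pos (d Δ : ℤ) (p : ℕ) (x : ℝ) (hx0 : 0 < x) (hx : x ≤ 1/2) : 0 < EP d Δ p x := by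
  have f1 := factor_bounds _ x hx0 hx (chi_abs d p)
  have f2 := factor_bounds _ x hx0 hx (chi_abs Δ p)
  have f3 := factor_bounds _ x hx0 hx (chi_abs (d*Δ) p)
  have f00 : 0 < (1 - x)⁻¹ := inv_pos.2 (by linarith)
  unfold EP
  positivity

section glob
variable {M : Type*} [Field M] [NumberField M]

open scoped Classical in
lemma ideal_sum_le (h4 : Module.finrank ℚ M = 4) (d Δ : ℤ) (hd0 : d ≠ 0) (c s : 𝓞 M) (hc : c^2 = (d : 𝓞 M)) (hs : s^2 = (Δ : 𝓞 M))
    (hΔ : ∀ p : ℕ, p.Prime → p ≠ 2 → ¬ (p:ℤ)^2 ∣ Δ) (σ : ℝ) (hσ : 1 < σ) (N : ℕ) (F : Finset (Ideal (𝓞 M)))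
    (hF : ∀ I ∈ F, I ≠ 0 ∧ Ideal.absNorm I < N) :
    ∑ I ∈ F, (Ideal.absNorm I : ℝ)^(-σ) ≤ 54 ^ ((2 * d.natAbs).primeFactors.card) * ∏ p ∈ N.primesBelow, EP d Δ p ((p:ℝ)^(-σ)) := by
  have hfin : {I : Ideal (𝓞 M) | Ideal.absNorm I ≤ N}.Finite := Ideal.finite_setOfPred_absNorm_le N
  set T := hfin.toFinset.filter (fun P => Prime P ∧ Ideal.absNorm P < N) with hT
  have hTm : ∀ P, P ∈ T ↔ Prime P ∧ Ideal.absNorm P < N := by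
    intro P; simp [hT]; intro _ h; exact h.le
  have hN1 : ∀ P : Ideal (𝓞 M), Prime P → 2 ≤ Ideal.absNorm P := by
    intro P hP
    have h0 : Ideal.absNorm P ≠ 0 := by
      rw [Ne, Ideal.absNorm_eq_zero_iff]; exact hP.ne_zero
    have h1 : Ideal.absNorm P ≠ 1 := by
      rw [Ne, Ideal.absNorm_eq_one_iff]; exact (Ideal.isPrime_of_prime hP).ne_top
    omega
  have h1 := euler_finite (α := Ideal (𝓞 M)) (fun I => (Ideal.absNorm I : ℝ)^(-σ)) (fun I => by positivity) (by simp)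
    (fun I J => by simp only [map_mul]; push_cast; exact Real.mul_rpow (by positivity) (by positivity)) T
    (fun P hP => by
      have hP := ((hTm P).1 hP).1
      refine ⟨hP, Real.rpow_lt_one_of_one_lt_of_neg ?_ (by linarith)⟩
      exact_mod_cast hN1 P hP) F
    (fun I hI => by
      refine ⟨(hF I hI).1, fun P hP hPI => (hTm P).2 ⟨hP, ?_⟩⟩
      refine lt_of_le_of_lt (Nat.le_of_dvd ?_ (map_dvd Ideal.absNorm hPI)) (hF I hI).2
      apply Nat.pos_of_ne_zero
      rw [Ne, Ideal.absNorm_eq_zero_iff]; exact (hF I hI).1)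
  refine h1.trans ?_
  -- the rational prime below
  have hbelow : ∀ P : Ideal (𝓞 M), Prime P → ∃ p : ℕ, p.Prime ∧ (p : 𝓞 M) ∈ P ∧ p ∣ Ideal.absNorm P := by
    intro P hP
    have hmem := Ideal.absNorm_mem P
    have hpr := Ideal.isPrime_of_prime hP
    have key : ∀ n : ℕ, n ≠ 0 → (n : 𝓞 M) ∈ P → ∃ p : ℕ, p.Prime ∧ (p : 𝓞 M) ∈ P ∧ p ∣ n := by
      intro n
      induction n using Nat.recOnMul with
      | zero => intro h; exact absurd rfl h
      | one => intro _ h; exact absurd ((Ideal.eq_top_iff_one P).2 (by simpa using h)) hpr.ne_top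
      | prime p hp => intro _ h; exact ⟨p, hp, h, dvd_rfl⟩
      | mul a b iha ihb =>
        intro h0 h
        push_cast at h
        rcases hpr.mem_or_mem h with h | h
        · obtain ⟨p, h1, h2, h3⟩ := iha (by rintro rfl; simp at h0) h
          exact ⟨p, h1, h2, h3.mul_right _⟩
        · obtain ⟨p, h1, h2, h3⟩ := ihb (by rintro rfl; simp at h0) h
          exact ⟨p, h1, h2, h3.mul_left _⟩
    exact key _ (by have := hN1 P hP; omega) hmem
  have : ∀ P : Ideal (𝓞 M), ∃ p : ℕ, Prime P → p.Prime ∧ (p : 𝓞 M) ∈ P ∧ p ∣ Ideal.absNorm P := by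
    intro P
    by_cases hP : Prime P
    · obtain ⟨p, hp⟩ := hbelow P hP; exact ⟨p, fun _ => hp⟩
    · exact ⟨0, fun h => absurd h hP⟩
  choose π hπ using this
  have hmaps : ∀ P ∈ T, π P ∈ N.primesBelow := by
    intro P hP
    obtain ⟨hP, hPN⟩ := (hTm P).1 hP
    obtain ⟨h1, h2, h3⟩ := hπ P hP
    rw [Nat.mem_primesBelow]
    refine ⟨lt_of_le_of_lt (Nat.le_of_dvd ?_ h3) hPN, h1⟩
    have := hN1 P hP; omega
  rw [← Finset.prod_fiberwise_of_maps_to hmaps]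
  have hloc : ∀ p ∈ N.primesBelow, ∏ P ∈ T with π P = p, (1 - (Ideal.absNorm P : ℝ)^(-σ))⁻¹ ≤
      (if p ∈ (2 * d.natAbs).primeFactors then 54 else 1) * EP d Δ p ((p:ℝ)^(-σ)) := by
    intro p hp
    have hpp := Nat.prime_of_mem_primesBelow hp
    have hx := rpow_half p hpp σ hσ
    have hTp : ∀ P ∈ T.filter (fun P => π P = p), Prime P ∧ (p : 𝓞 M) ∈ P ∧ p ∣ Ideal.absNorm P := by
      intro P hP
      rw [Finset.mem_filter] at hP
      have h1 := ((hTm P).1 hP.1).1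
      have h2 := hπ P h1
      rw [hP.2] at h2
      exact ⟨h1, h2.2⟩
    split_ifs with hbad
    · exact local_bad h4 d Δ p hpp σ hσ _ hx (fun P hP => ⟨(hTp P hP).1, (hTp P hP).2.1⟩) (fun P hP => (hTp P hP).2.2)
    · rw [one_mul]
      have hn : ¬ p ∣ 2 * d.natAbs := by
        intro h; apply hbad
        rw [Nat.mem_primeFactors]; exact ⟨hpp, h, by simpa using hd0⟩
      have hp2 : p ≠ 2 := by rintro rfl; exact hn (dvd_mul_right _ _)
      refine local_good h4 d Δ c s hc hs p hpp hp2 ?_ (hΔ p hpp hp2) σ hσ _ hx (fun P hP => ⟨(hTp P hP).1, (hTp P hP).2.1⟩)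
      intro h
      exact hn ((Int.natCast_dvd.1 h).mul_left _)
  refine (Finset.prod_le_prod (fun p hp => ?_) hloc).trans ?_
  · refine Finset.prod_nonneg fun P hP => inv_nonneg.2 ?_
    rw [Finset.mem_filter] at hP
    have := hN1 P ((hTm P).1 hP.1).1
    have : (Ideal.absNorm P : ℝ)^(-σ) ≤ 1 := Real.rpow_le_one_of_one_le_of_nonpos (by exact_mod_cast (by omega : 1 ≤ Ideal.absNorm P)) (by linarith)
    linarith
  rw [Finset.prod_mul_distrib]
  refine mul_le_mul_of_nonneg_right ?_ (Finset.prod_nonneg fun p hp => ?_)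
  · rw [← Finset.prod_filter, Finset.prod_const]
    apply pow_le_pow_right₀ (by norm_num)
    apply Finset.card_le_card
    intro p hp
    exact (Finset.mem_filter.1 hp).2
  · have hpp := Nat.prime_of_mem_primesBelow hp
    exact (EP_pos d Δ p _ (Real.rpow_pos_of_pos (by exact_mod_cast hpp.pos) _) (rpow_half p hpp σ hσ)).le

noncomputable def cnt (M : Type*) [Field M] [NumberField M] (n : ℕ) : ℕ := Nat.card {I : Ideal (𝓞 M) // Ideal.absNorm I = n}

open scoped Classical in
lemma cnt_sum (σ : ℝ) (hσ : 1 < σ) (N : ℕ) : ∃ F : Finset (Ideal (𝓞 M)), (∀ I ∈ F, I ≠ 0 ∧ Ideal.absNorm I < N) ∧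
    ∑ n ∈ Finset.range N, (cnt M n : ℝ) * (n:ℝ)^(-σ) = ∑ I ∈ F, (Ideal.absNorm I : ℝ)^(-σ) := by
  have hfin : {I : Ideal (𝓞 M) | Ideal.absNorm I ≤ N}.Finite := Ideal.finite_setOfPred_absNorm_le N
  set F := hfin.toFinset.filter (fun I => I ≠ 0 ∧ Ideal.absNorm I < N) with hF
  have hFm : ∀ I, I ∈ F ↔ I ≠ 0 ∧ Ideal.absNorm I < N := by
    intro P; simp [hF]; intro _ h; exact h.le
  refine ⟨F, fun I hI => (hFm I).1 hI, ?_⟩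
  rw [← Finset.sum_fiberwise_of_maps_to (g := fun I => Ideal.absNorm I) (t := Finset.range N) (fun I hI => Finset.mem_range.2 ((hFm I).1 hI).2)]
  refine Finset.sum_congr rfl fun n hn => ?_
  rw [Finset.mem_range] at hn
  rcases Nat.eq_zero_or_pos n with rfl | hn0
  · rw [Finset.sum_eq_zero]
    · simp [Real.zero_rpow (show -σ ≠ 0 by linarith)]
    · intro I hI
      rw [Finset.mem_filter] at hI
      exact absurd (Ideal.absNorm_eq_zero_iff.1 hI.2) ((hFm I).1 hI.1).1
  · rw [Finset.sum_congr rfl (g := fun _ => (n:ℝ)^(-σ)) (fun I hI => by rw [(Finset.mem_filter.1 hI).2]), Finset.sum_const, nsmul_eq_mul]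
    congr 2
    rw [cnt]
    refine Nat.subtype_card _ fun I => ?_
    rw [Finset.mem_filter, hFm]
    refine ⟨fun h => h.2, fun h => ⟨⟨?_, by omega⟩, h⟩⟩
    intro h0
    have := Ideal.absNorm_eq_zero_iff.2 h0
    omega
end glob

end

section

open NumberField Filter Topology

noncomputable def chiS (a : ℤ) (σ : ℝ) : ℕ →*₀ ℝ where
  toFun n := chi a n * (n:ℝ)^(-σ)
  map_zero' := by simp [chi_zero]
  map_one' := by simp [chi_one]
  map_mul' m n := by
    rw [chi_mul]; push_cast; rw [Real.mul_rpow (by positivity) (by positivity)]; ring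

noncomputable def zetaS (σ : ℝ) (hσ : 1 < σ) : ℕ →*₀ ℝ where
  toFun n := (n:ℝ)^(-σ)
  map_zero' := by simp [Real.zero_rpow (show -σ ≠ 0 by linarith)]
  map_one' := by simp
  map_mul' m n := by push_cast; exact Real.mul_rpow (by positivity) (by positivity)

noncomputable def LL (a : ℤ) (σ : ℝ) : ℝ := ∑' n : ℕ, chi a n * (n:ℝ)^(-σ)

lemma summable_z (σ : ℝ) (hσ : 1 < σ) : Summable (fun n : ℕ => (n:ℝ)^(-σ)) := Real.summable_nat_rpow.2 (by linarith)
lemma summable_chi (a : ℤ) (σ : ℝ) (hσ : 1 < σ) : Summable (fun n : ℕ => ‖chi a n * (n:ℝ)^(-σ)‖) := by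
  refine Summable.of_nonneg_of_le (fun n => norm_nonneg _) (fun n => ?_) (summable_z σ hσ)
  rw [norm_mul, Real.norm_eq_abs, Real.norm_of_nonneg (by positivity : (0:ℝ) ≤ (n:ℝ)^(-σ))]
  calc _ ≤ 1 * (n:ℝ)^(-σ) := by gcongr; exact chi_abs a n
    _ = _ := one_mul _

lemma LL_euler (a : ℤ) (σ : ℝ) (hσ : 1 < σ) : Tendsto (fun N : ℕ => ∏ p ∈ N.primesBelow, (1 - chi a p * (p:ℝ)^(-σ))⁻¹) atTop (𝓝 (LL a σ)) :=
  EulerProduct.eulerProduct_completely_multiplicative (f := chiS a σ) (summable_chi a σ hσ)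

lemma z_euler (σ : ℝ) (hσ : 1 < σ) : Tendsto (fun N : ℕ => ∏ p ∈ N.primesBelow, (1 - (p:ℝ)^(-σ))⁻¹) atTop (𝓝 (∑' n : ℕ, (n:ℝ)^(-σ))) :=
  EulerProduct.eulerProduct_completely_multiplicative (f := zetaS σ hσ) (by
    refine (summable_z σ hσ).congr fun n => ?_
    change _ = ‖(n:ℝ)^(-σ)‖
    rw [Real.norm_of_nonneg (by positivity)])

lemma LL_nonneg (a : ℤ) (σ : ℝ) (hσ : 1 < σ) : 0 ≤ LL a σ := by
  refine ge_of_tendsto' (LL_euler a σ hσ) fun N => Finset.prod_nonneg fun p hp => ?_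
  have hpp := Nat.prime_of_mem_primesBelow hp
  have := factor_bounds _ _ (Real.rpow_pos_of_pos (by exact_mod_cast hpp.pos) _) (rpow_half p hpp σ hσ) (chi_abs a p)
  linarith

noncomputable def SS (a : ℤ) (U : ℕ) (σ : ℝ) : ℝ := ∑ m ∈ Finset.Ioc 0 U, chi a m * (m:ℝ)^(-σ)

lemma LL_le (a : ℤ) (ha : ¬ IsSquare a) (σ : ℝ) (hσ : 1 < σ) (U : ℕ) (hU : 0 < U) : LL a σ ≤ SS a U σ + 4 * a.natAbs / U := by
  have hs : Summable (fun n : ℕ => chi a n * (n:ℝ)^(-σ)) := (summable_chi a σ hσ).of_norm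
  refine le_of_tendsto (hs.hasSum.tendsto_sum_nat) ?_
  filter_upwards [eventually_ge_atTop (U+1)] with V hV
  have h1 := abel_bound (chi a) (fun m => (m:ℝ)^(-σ)) (4 * (a.natAbs:ℝ)) (U+1) V
    (fun i hi => by
      apply Real.rpow_le_rpow_of_nonpos
      · exact_mod_cast (by omega : 0 < i)
      · push_cast; linarith
      · linarith) (fun i _ => by positivity) (fun v => chi_sum_bound a ha _ v)
  have hU' : (1:ℝ) ≤ U := by exact_mod_cast hU
  have h2 : ((U+1 : ℕ):ℝ)^(-σ) ≤ 1 / U := by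
    calc ((U+1 : ℕ):ℝ)^(-σ) ≤ ((U+1 : ℕ):ℝ)^(-1:ℝ) := Real.rpow_le_rpow_of_exponent_le (by push_cast; linarith) (by linarith)
      _ = 1 / ((U+1 : ℕ):ℝ) := by rw [Real.rpow_neg_one, one_div]
      _ ≤ 1 / U := one_div_le_one_div_of_le (by linarith) (by push_cast; linarith)
  have h3 : ∑ i ∈ Finset.range V, chi a i * (i:ℝ)^(-σ) = SS a U σ + ∑ i ∈ Finset.Ico (U+1) V, (i:ℝ)^(-σ) * chi a i := by
    rw [Finset.range_eq_Ico, ← Finset.sum_Ico_consecutive _ (Nat.zero_le (U+1)) hV]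
    congr 1
    · rw [Finset.sum_eq_sum_Ico_succ_bot (by omega), chi_zero, zero_mul, zero_add]
      unfold SS
      refine Finset.sum_congr ?_ fun _ _ => rfl
      ext x; simp; omega
    · exact Finset.sum_congr rfl fun i _ => mul_comm _ _
  rw [h3]
  have h4 := (abs_le.1 h1).2
  have : 4 * (a.natAbs:ℝ) * ((U+1 : ℕ):ℝ)^(-σ) ≤ 4 * a.natAbs / U := by
    rw [div_eq_mul_one_div]; gcongr
  linarith

lemma SS_tendsto (a : ℤ) (U : ℕ) : Tendsto (fun σ : ℝ => SS a U σ) (𝓝[>] 1) (𝓝 (SU a U)) := by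
  apply Tendsto.mono_left _ nhdsWithin_le_nhds
  unfold SS SU
  refine tendsto_finsetSum _ fun m hm => ?_
  have hm0 : (m:ℝ) ≠ 0 := by
    have := (Finset.mem_Ioc.1 hm).1
    exact_mod_cast this.ne'
  have h1 : Tendsto (fun σ : ℝ => (m:ℝ)^(-σ)) (𝓝 1) (𝓝 ((m:ℝ)^(-1:ℝ))) :=
    (Real.continuousAt_const_rpow hm0).tendsto.comp (continuous_neg.tendsto (1:ℝ))
  have h2 := h1.const_mul (chi a m)
  rw [Real.rpow_neg_one, ← div_eq_mul_inv] at h2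
  exact h2

section glob
variable {M : Type*} [Field M] [NumberField M]

lemma zeta_le (h4 : Module.finrank ℚ M = 4) (d Δ : ℤ) (hd0 : d ≠ 0) (c s : 𝓞 M) (hc : c^2 = (d : 𝓞 M)) (hs : s^2 = (Δ : 𝓞 M))
    (hΔ : ∀ p : ℕ, p.Prime → p ≠ 2 → ¬ (p:ℤ)^2 ∣ Δ) (σ : ℝ) (hσ : 1 < σ) :
    ∑' n : ℕ, (cnt M n : ℝ) * (n:ℝ)^(-σ) ≤ 54 ^ ((2 * d.natAbs).primeFactors.card) *
      ((∑' n : ℕ, (n:ℝ)^(-σ)) * LL d σ * LL Δ σ * LL (d*Δ) σ) := by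
  refine Real.tsum_le_of_sum_range_le (fun n => by positivity) fun K => ?_
  have h1 := ((((z_euler σ hσ).mul (LL_euler d σ hσ)).mul (LL_euler Δ σ hσ)).mul (LL_euler (d*Δ) σ hσ)).const_mul ((54:ℝ) ^ ((2 * d.natAbs).primeFactors.card))
  refine ge_of_tendsto h1 ?_
  filter_upwards [eventually_ge_atTop K] with N hN
  obtain ⟨F, hF, hsum⟩ := cnt_sum (M := M) σ hσ N
  have h2 := ideal_sum_le h4 d Δ hd0 c s hc hs hΔ σ hσ N F hF
  rw [← hsum] at h2
  simp only [← Finset.prod_mul_distrib]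
  refine le_trans (Finset.sum_le_sum_of_subset_of_nonneg (Finset.range_mono hN) fun _ _ _ => by positivity) h2

lemma dedekind_real (σ : ℝ) (hσ : 1 < σ) : dedekindZeta M (σ:ℂ) = ((∑' n : ℕ, (cnt M n : ℝ) * (n:ℝ)^(-σ) : ℝ) : ℂ) := by
  rw [dedekindZeta, LSeries, Complex.ofReal_tsum]
  refine tsum_congr fun n => ?_
  rcases Nat.eq_zero_or_pos n with rfl | hn
  · simp [Real.zero_rpow (show -σ ≠ 0 by linarith)]
  · rw [LSeries.term_of_ne_zero hn.ne', Real.rpow_neg (by positivity), Complex.ofReal_mul, Complex.ofReal_inv, Complex.ofReal_cpow (by positivity)]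
    simp [cnt, div_eq_mul_inv]

lemma residue_le (h4 : Module.finrank ℚ M = 4) (d Δ : ℤ) (hd : ¬ IsSquare d) (hΔs : ¬ IsSquare Δ) (hdΔ : ¬ IsSquare (d * Δ))
    (c s : 𝓞 M) (hc : c^2 = (d : 𝓞 M)) (hs : s^2 = (Δ : 𝓞 M))
    (hΔ : ∀ p : ℕ, p.Prime → p ≠ 2 → ¬ (p:ℤ)^2 ∣ Δ) (U : ℕ) (hU : 0 < U) :
    dedekindZeta_residue M ≤ 54 ^ ((2 * d.natAbs).primeFactors.card) * (1 + 4 * d.natAbs) *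
      ((SU Δ U + 4 * Δ.natAbs / U) * (SU (d*Δ) U + 4 * (d*Δ).natAbs / U)) := by
  have hd0 : d ≠ 0 := by rintro rfl; simp at hd
  have h1 : Tendsto (fun σ : ℝ => (σ - 1) * ∑' n : ℕ, (cnt M n : ℝ) * (n:ℝ)^(-σ)) (𝓝[>] 1) (𝓝 (dedekindZeta_residue M)) := by
    have := (Complex.continuous_re.tendsto _).comp (tendsto_sub_one_mul_dedekindZeta_nhdsGT M)
    rw [Complex.ofReal_re] at this
    refine this.congr' ?_
    filter_upwards [self_mem_nhdsWithin] with σ hσ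
    simp only [Function.comp_apply]
    rw [dedekind_real σ hσ]
    norm_cast
  have hz : Tendsto (fun σ : ℝ => (σ - 1) * ∑' n : ℕ, (n:ℝ)^(-σ)) (𝓝[>] 1) (𝓝 1) := by
    refine tendsto_sub_mul_tsum_nat_rpow.congr fun σ => ?_
    congr 1
    refine tsum_congr fun n => ?_
    rw [Real.rpow_neg (by positivity), one_div]
  have h2 := ((hz.mul (((SS_tendsto Δ U).add_const (4 * (Δ.natAbs:ℝ) / U)).mul ((SS_tendsto (d*Δ) U).add_const (4 * ((d*Δ).natAbs:ℝ) / U)))).const_mul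
    ((54:ℝ) ^ ((2 * d.natAbs).primeFactors.card) * (1 + 4 * d.natAbs)))
  rw [one_mul] at h2
  refine le_of_tendsto_of_tendsto h1 h2 ?_
  filter_upwards [self_mem_nhdsWithin] with σ hσ
  have hσ : 1 < σ := hσ
  have hσ0 : 0 < σ - 1 := by linarith
  have k0 := zeta_le h4 d Δ hd0 c s hc hs hΔ σ hσ
  have k1 : LL d σ ≤ 1 + 4 * d.natAbs := by
    have := LL_le d hd σ hσ 1 one_pos
    simpa [SS, chi_one] using this
  have k2 := LL_le Δ hΔs σ hσ U hU
  have k3 := LL_le (d*Δ) hdΔ σ hσ U hU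
  have p1 := LL_nonneg d σ hσ
  have p2 := LL_nonneg Δ σ hσ
  have p3 := LL_nonneg (d*Δ) σ hσ
  have pz : 0 ≤ ∑' n : ℕ, (n:ℝ)^(-σ) := tsum_nonneg fun n => by positivity
  set Z := ∑' n : ℕ, (n:ℝ)^(-σ)
  calc (σ - 1) * ∑' n : ℕ, (cnt M n : ℝ) * (n:ℝ)^(-σ)
      ≤ (σ - 1) * (54 ^ ((2 * d.natAbs).primeFactors.card) * (Z * LL d σ * LL Δ σ * LL (d*Δ) σ)) := by gcongr
    _ = (54 ^ ((2 * d.natAbs).primeFactors.card) * LL d σ) * (((σ - 1) * Z) * (LL Δ σ * LL (d*Δ) σ)) := by ring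
    _ ≤ _ := by gcongr; linarith
end glob

end

section

open NumberField

lemma w_dvd (n : ℕ) (hn : 0 < n) (h : n.totient ≤ 4) : n ∣ 120 := by
  rw [Nat.dvd_iff_prime_pow_dvd_dvd]
  intro p k hp hk
  have h1 : (p^k).totient ≤ 4 :=
    (Nat.le_of_dvd (Nat.totient_pos.2 hn) (Nat.totient_dvd_of_dvd hk)).trans h
  rcases Nat.eq_zero_or_pos k with rfl | hk0
  · simp
  obtain ⟨j, rfl⟩ : ∃ j, k = j + 1 := ⟨k-1, by omega⟩
  rw [Nat.totient_prime_pow_succ hp] at h1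
  have hp2 := hp.two_le
  have hpp : p ≤ 5 := by
    have : 1 * (p - 1) ≤ 4 := le_trans (Nat.mul_le_mul_right _ (Nat.one_le_pow _ _ hp.pos)) h1
    omega
  have hj : j ≤ 2 := by
    by_contra hj
    have h3 : 2^3 ≤ p^j := (Nat.pow_le_pow_left hp2 3).trans (Nat.pow_le_pow_right hp.pos (by omega))
    have : 8 * 1 ≤ p^j * (p-1) := Nat.mul_le_mul h3 (by omega)
    omega
  interval_cases p <;> interval_cases j <;> first | (exfalso; revert hp; norm_num; done) | (exfalso; revert h1; norm_num; done) | norm_num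

section
variable {M : Type*} [Field M] [NumberField M]

lemma w_le (h4 : Module.finrank ℚ M = 4) : Units.torsionOrder M ≤ 120 := by
  obtain ⟨g, hg⟩ := IsCyclic.exists_ofOrder_eq_natCard (α := Units.torsion M)
  have hpos := Units.torsionOrder_pos M
  have h1 : IsPrimitiveRoot g (Units.torsionOrder M) := by
    have := IsPrimitiveRoot.orderOf g
    rwa [hg] at this
  have h2 : IsPrimitiveRoot (((g : (𝓞 M)ˣ) : 𝓞 M) : M) (Units.torsionOrder M) := by
    have a1 := h1.map_of_injective (f := (Units.torsion M).subtype) Subtype.val_injective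
    have a2 := a1.map_of_injective (f := Units.coeHom (𝓞 M)) Units.val_injective
    exact a2.map_of_injective (f := algebraMap (𝓞 M) M) RingOfIntegers.coe_injective
  have h3 := h2.totient_le_degree_minpoly
  have h5 : (minpoly ℤ (((g : (𝓞 M)ˣ) : 𝓞 M) : M)).natDegree ≤ 4 := by
    have := minpoly.isIntegrallyClosed_eq_field_fractions' ℚ (RingOfIntegers.isIntegral_coe (((g : (𝓞 M)ˣ) : 𝓞 M)))
    have h6 := minpoly.natDegree_le (A := ℚ) (((g : (𝓞 M)ˣ) : 𝓞 M) : M)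
    rw [this, (minpoly.monic (RingOfIntegers.isIntegral_coe _)).natDegree_map, h4] at h6
    exact h6
  exact Nat.le_of_dvd (by norm_num) (w_dvd _ hpos (h3.trans h5))

lemma not_sq_rat {a : ℤ} (ha : ¬ IsSquare a) (q : ℚ) : q^2 ≠ a := by
  intro h
  apply ha
  have : IsSquare ((a:ℤ):ℚ) := ⟨q, by rw [← h]; ring⟩
  exact Rat.isSquare_intCast_iff.1 this

open Polynomial in
lemma trace_sqrt {a : ℤ} (ha : ¬ IsSquare a) (x : 𝓞 M) (hx : x^2 = (a : 𝓞 M)) : Algebra.trace ℤ (𝓞 M) x = 0 := by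
  have hx' : (x : M)^2 = (a : M) := by
    have := congrArg (algebraMap (𝓞 M) M) hx
    simpa using this
  have hmin : minpoly ℚ (x : M) = X^2 - C (a:ℚ) := by
    symm
    apply minpoly.eq_of_irreducible_of_monic
    · exact X_pow_sub_C_irreducible_of_prime Nat.prime_two (fun b hb => not_sq_rat ha b hb)
    · simp [hx']
    · exact monic_X_pow_sub_C _ two_ne_zero
  have : ((Algebra.trace ℤ (𝓞 M) x : ℤ) : ℚ) = 0 := by
    rw [Algebra.coe_trace_int, trace_eq_finrank_mul_minpoly_nextCoeff, hmin]
    have : (X^2 - C (a:ℚ)).nextCoeff = 0 := by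
      rw [nextCoeff_of_natDegree_pos (by rw [natDegree_X_pow_sub_C]; norm_num), natDegree_X_pow_sub_C]
      rw [coeff_sub, coeff_X_pow, coeff_C]; norm_num
    rw [this]; simp
  exact_mod_cast this

lemma trace_int' (h4 : Module.finrank ℚ M = 4) (a : ℤ) : Algebra.trace ℤ (𝓞 M) (a : 𝓞 M) = 4 * a := by
  have : ((Algebra.trace ℤ (𝓞 M) (a : 𝓞 M) : ℤ) : ℚ) = ((4 * a : ℤ) : ℚ) := by
    rw [Algebra.coe_trace_int]
    have := Algebra.trace_algebraMap (R := ℚ) (S := M) (a : ℚ)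
    rw [h4] at this
    simpa using this
  exact_mod_cast this

lemma trace_mul_sqrt {a e : ℤ} (ha : ¬ IsSquare a) (x : 𝓞 M) (hx : x^2 = (a : 𝓞 M)) : Algebra.trace ℤ (𝓞 M) ((e : 𝓞 M) * x) = 0 := by
  rw [← zsmul_eq_mul, map_zsmul, trace_sqrt ha x hx, smul_zero]

lemma discr_le (h4 : Module.finrank ℚ M = 4) (d Δ : ℤ) (hd : ¬ IsSquare d) (hΔs : ¬ IsSquare Δ) (hdΔ : ¬ IsSquare (d * Δ))
    (c s : 𝓞 M) (hc : c^2 = (d : 𝓞 M)) (hs : s^2 = (Δ : 𝓞 M)) : |discr M| ≤ (16 * d * Δ)^2 := by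
  have hcard : Fintype.card (Module.Free.ChooseBasisIndex ℤ (𝓞 M)) = 4 := by
    rw [← Module.finrank_eq_card_chooseBasisIndex, RingOfIntegers.rank, h4]
  let b := (RingOfIntegers.basis M).reindex (Fintype.equivFinOfCardEq hcard)
  let v : Fin 4 → 𝓞 M := ![1, c, s, c * s]
  have hcs : (c*s)^2 = ((d*Δ : ℤ) : 𝓞 M) := by rw [mul_pow, hc, hs]; push_cast; ring
  have h1 : Algebra.discr ℤ v = (b.toMatrix v).det^2 * discr M := by
    rw [← discr_eq_discr M b, ← Algebra.discr_of_matrix_vecMul, Module.Basis.toMatrix_map_vecMul]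
  have tc := trace_sqrt hd c hc
  have ts := trace_sqrt hΔs s hs
  have tcs := trace_sqrt hdΔ (c*s) hcs
  have h2 : Algebra.discr ℤ v = (16*d*Δ)^2 := by
    have : Algebra.traceMatrix ℤ v = Matrix.diagonal ![4, 4*d, 4*Δ, 4*(d*Δ)] := by
      ext i j
      rw [Algebra.traceMatrix_apply, Algebra.traceForm_apply]
      fin_cases i <;> fin_cases j <;> simp [v, Matrix.diagonal]
      · simpa using trace_int' h4 1
      · exact tc
      · exact ts
      · exact tcs
      · exact tc
      · rw [← pow_two, hc, trace_int' h4]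
      · exact tcs
      · rw [← mul_assoc, ← pow_two, hc, trace_mul_sqrt hΔs s hs]
      · exact ts
      · rw [mul_comm, tcs]
      · rw [← pow_two, hs, trace_int' h4]
      · rw [show s * (c * s) = s^2 * c by ring, hs, trace_mul_sqrt hd c hc]
      · exact tcs
      · rw [show c * s * c = c^2 * s by ring, hc, trace_mul_sqrt hΔs s hs]
      · rw [show c * s * s = s^2 * c by ring, hs, trace_mul_sqrt hd c hc]
      · rw [← pow_two, hcs, trace_int' h4]
    rw [Algebra.discr_def, this, Matrix.det_diagonal]
    simp [Fin.prod_univ_succ]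
    ring
  have hd0 : d ≠ 0 := by rintro rfl; simp at hd
  have hΔ0 : Δ ≠ 0 := by rintro rfl; simp at hΔs
  rw [← h2, h1]
  have h3 : (b.toMatrix v).det ≠ 0 := by
    intro h0
    rw [h2, h0] at h1
    simp [hd0, hΔ0] at h1
  have h5 : 1 ≤ (b.toMatrix v).det^2 := by
    have : 0 < (b.toMatrix v).det^2 := by positivity
    omega
  have h6 : 0 < (b.toMatrix v).det^2 * discr M := by
    rw [← h1, h2]; positivity
  have h7 : 0 < discr M := by nlinarith [h6, h5]
  rw [abs_of_pos h7]
  nlinarith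

lemma kappa_eq : kappa M = dedekindZeta_residue M := by
  rw [kappa, dedekindZeta_residue]; ring

lemma hR_le (h4 : Module.finrank ℚ M = 4) (d Δ : ℤ) (hd : ¬ IsSquare d) (hΔs : ¬ IsSquare Δ) (hdΔ : ¬ IsSquare (d * Δ))
    (c s : 𝓞 M) (hc : c^2 = (d : 𝓞 M)) (hs : s^2 = (Δ : 𝓞 M)) :
    (classNumber M : ℝ) * Units.regulator M ≤ 1920 * |(d:ℝ)| * |(Δ:ℝ)| * kappa M := by
  have hw : (Units.torsionOrder M : ℝ) ≤ 120 := by exact_mod_cast w_le h4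
  have hw0 : (0:ℝ) < Units.torsionOrder M := by exact_mod_cast Units.torsionOrder_pos M
  have hD : Real.sqrt |(discr M : ℝ)| ≤ 16 * |(d:ℝ)| * |(Δ:ℝ)| := by
    apply Real.sqrt_le_iff.2 ⟨by positivity, ?_⟩
    have := discr_le h4 d Δ hd hΔs hdΔ c s hc hs
    have h2 : |(discr M : ℝ)| ≤ (16 * d * Δ)^2 := by exact_mod_cast this
    refine h2.trans_eq ?_
    rw [mul_pow, mul_pow, mul_pow, mul_pow, sq_abs, sq_abs]
  have hD0 : 0 < Real.sqrt |(discr M : ℝ)| := Real.sqrt_pos_of_pos <| abs_pos.mpr (Int.cast_ne_zero.mpr (discr_ne_zero M))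
  have hR := Units.regulator_pos M
  have hx : 0 ≤ (classNumber M : ℝ) * Units.regulator M := by positivity
  have e1 : (1:ℝ) ≤ 2 ^ (InfinitePlace.nrRealPlaces M) := one_le_pow₀ (by norm_num)
  have e2 : (1:ℝ) ≤ (2 * Real.pi) ^ (InfinitePlace.nrComplexPlaces M) := one_le_pow₀ (by linarith [Real.pi_gt_three])
  have e3 : (classNumber M : ℝ) * Units.regulator M ≤ kappa M * ((Units.torsionOrder M : ℝ) * Real.sqrt |(discr M : ℝ)|) := by
    rw [kappa, div_mul_cancel₀ _ (by positivity)]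
    have := one_le_mul_of_one_le_of_one_le e1 e2
    rw [mul_assoc (_ * _)]
    exact le_mul_of_one_le_left hx this
  have hk : 0 ≤ kappa M := by rw [kappa]; positivity
  calc _ ≤ _ := e3
    _ ≤ kappa M * (120 * (16 * |(d:ℝ)| * |(Δ:ℝ)|)) := by gcongr
    _ = _ := by ring

end

lemma sqf_not_square {d : ℤ} (h : Squarefree d) (h1 : d ≠ 1) : ¬ IsSquare d := by
  rintro ⟨r, rfl⟩
  have := h r dvd_rfl
  rcases Int.isUnit_iff.1 this with rfl | rfl <;> simp at h1

lemma sqf_mul_square {a b : ℤ} (ha : Squarefree a) (hb : Squarefree b) (h : IsSquare (a * b)) : a = b := by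
  obtain ⟨r, hr⟩ := h
  have key : ∀ {a b : ℤ}, Squarefree a → a * b = r * r → a ∣ b := by
    intro a b ha hr
    have : a ∣ r := (ha.dvd_pow_iff_dvd two_ne_zero).1 ⟨b, by rw [pow_two, hr]⟩
    obtain ⟨t, rfl⟩ := this
    refine ⟨t * t, ?_⟩
    apply mul_left_cancel₀ ha.ne_zero
    rw [hr]; ring
  have h1 := key ha hr
  have h2 := key hb (by rw [mul_comm, hr])
  rcases Int.associated_iff.1 (associated_of_dvd_dvd h1 h2) with h | h
  · exact h
  · exfalso
    rw [h] at hr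
    have := hb.ne_zero
    nlinarith [mul_self_nonneg r, mul_self_pos.2 this]

lemma fund_facts {d Δ : ℤ} (hsq : Squarefree d) (h : IsFundamentalDiscriminant Δ) (hne : Δ ≠ DL d) :
    ¬ IsSquare Δ ∧ ¬ IsSquare (d * Δ) ∧ (∀ p : ℕ, p.Prime → p ≠ 2 → ¬ (p:ℤ)^2 ∣ Δ) ∧ 3 ≤ Δ.natAbs := by
  obtain ⟨h1, ⟨h2, h3⟩ | ⟨m, rfl, h3, h4⟩⟩ := h
  · refine ⟨sqf_not_square h3 h1, fun h => ?_, fun p hp _ hpd => ?_, ?_⟩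
    · have := sqf_mul_square hsq h3 h
      subst this
      exact hne (by rw [DL, if_pos h2])
    · rw [pow_two] at hpd
      exact hp.one_lt.ne' (by simpa [Int.isUnit_iff_natAbs_eq] using h3 _ hpd)
    · omega
  · have hm1 : m ≠ 1 := by rintro rfl; omega
    refine ⟨fun h => ?_, fun h => ?_, fun p hp hp2 hpd => ?_, ?_⟩
    · obtain ⟨r, hr⟩ := h
      have : (2:ℤ) ∣ r := by
        have : (2:ℤ) ∣ r * r := ⟨2*m, by rw [← hr]; ring⟩
        rcases Int.prime_two.dvd_or_dvd this with h | h <;> exact h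
      obtain ⟨t, rfl⟩ := this
      exact sqf_not_square h3 hm1 ⟨t, by linarith⟩
    · obtain ⟨r, hr⟩ := h
      have : (2:ℤ) ∣ r := by
        have : (2:ℤ) ∣ r * r := ⟨2*(d*m), by rw [← hr]; ring⟩
        rcases Int.prime_two.dvd_or_dvd this with h | h <;> exact h
      obtain ⟨t, rfl⟩ := this
      have := sqf_mul_square hsq h3 ⟨t, by linarith⟩
      subst this
      exact hne (by rw [DL, if_neg (by omega)])
    · have hcop : IsCoprime ((p:ℤ)^2) 4 := by
        rw [Int.isCoprime_iff_gcd_eq_one]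
        have : Nat.Coprime (p^2) (2^2) := Nat.Coprime.pow _ _ ((Nat.coprime_primes hp Nat.prime_two).2 hp2)
        simpa [Int.gcd] using this
      have := hcop.dvd_of_dvd_mul_left hpd
      rw [pow_two] at this
      exact hp.one_lt.ne' (by simpa [Int.isUnit_iff_natAbs_eq] using h3 _ this)
    · have := h3.ne_zero
      omega

/-- all that is needed about one field -/
lemma field_bound {M : Type*} [Field M] [NumberField M] {d Δ : ℤ} (hsq : Squarefree d) (hd1 : d ≠ 1)
    (hf : IsFundamentalDiscriminant Δ) (hne : Δ ≠ DL d)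
    (h4 : Module.finrank ℚ M = 4) (hc : ∃ c : M, c^2 = (d : M)) (hs : ∃ s : M, s^2 = (Δ : M)) :
    (classNumber M : ℝ) * Units.regulator M ≤ 1920 * |(d:ℝ)| * |(Δ:ℝ)| * kappa M ∧
    0 ≤ kappa M ∧ 0 ≤ (classNumber M : ℝ) * Units.regulator M ∧
    ∀ U : ℕ, 0 < U → kappa M ≤ 54 ^ ((2 * d.natAbs).primeFactors.card) * (1 + 4 * d.natAbs) *
      ((SU Δ U + 4 * Δ.natAbs / U) * (SU (d*Δ) U + 4 * (d*Δ).natAbs / U)) := by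
  obtain ⟨c, hc⟩ := hc
  obtain ⟨s, hs⟩ := hs
  have lift : ∀ (x : M) (a : ℤ), x^2 = (a : M) → ∃ y : 𝓞 M, y^2 = (a : 𝓞 M) := by
    intro x a hx
    have : IsIntegral ℤ x := by
      apply IsIntegral.of_pow (n := 2) (by norm_num)
      rw [hx]
      exact isIntegral_algebraMap (R := ℤ) (x := a)
    obtain ⟨y, hy⟩ : ∃ y : 𝓞 M, algebraMap (𝓞 M) M y = x := ⟨⟨x, this⟩, rfl⟩
    refine ⟨y, ?_⟩
    apply RingOfIntegers.coe_injective
    rw [map_pow, map_intCast, hy]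
    exact hx
  obtain ⟨c', hc'⟩ := lift c d hc
  obtain ⟨s', hs'⟩ := lift s Δ hs
  obtain ⟨f1, f2, f3, -⟩ := fund_facts hsq hf hne
  have hd := sqf_not_square hsq hd1
  refine ⟨hR_le h4 d Δ hd f1 f2 c' s' hc' hs', ?_, ?_, fun U hU => ?_⟩
  · rw [kappa_eq]; exact (dedekindZeta_residue_pos M).le
  · have := Units.regulator_pos M
    positivity
  · rw [kappa_eq]
    exact residue_le h4 d Δ hd f1 f2 c' s' hc' hs' f3 U hU

end

section

open NumberField Filter Topology

lemma SU_nonneg (a : ℤ) (ha : ¬ IsSquare a) (U : ℕ) (hU : 0 < U) : 0 ≤ SU a U + 4 * a.natAbs / U := by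
  refine ge_of_tendsto ((SS_tendsto a U).add_const (4 * (a.natAbs:ℝ) / U)) ?_
  filter_upwards [self_mem_nhdsWithin] with σ hσ
  exact (LL_nonneg a σ hσ).trans (LL_le a ha σ hσ U hU)

lemma exists_Y (X : ℕ) (hX : 3 ≤ X) : ∃ Y : ℕ, 2 ≤ Y ∧ Y ≤ X ∧ Real.log Y ≤ (Real.log X)^((11:ℝ)/14) ∧
    Real.log X / Real.log Y ≤ 4 * (Real.log X)^((3:ℝ)/14) := by
  have hX0 : (3:ℝ) ≤ X := by exact_mod_cast hX
  have hL : 1 ≤ Real.log X := by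
    rw [Real.le_log_iff_exp_le (by linarith)]
    linarith [Real.exp_one_lt_d9]
  set L := Real.log X with hLdef
  set t := L^((11:ℝ)/14) with ht
  have ht1 : 1 ≤ t := Real.one_le_rpow hL (by norm_num)
  have htL : t ≤ L := by
    have := Real.rpow_le_rpow_of_exponent_le hL (show (11:ℝ)/14 ≤ 1 by norm_num)
    rwa [Real.rpow_one] at this
  have he : 2 ≤ Real.exp t := by
    have := Real.add_one_le_exp t
    linarith
  have hfl : ((⌊Real.exp t⌋₊ : ℕ) : ℝ) ≤ Real.exp t := Nat.floor_le (by positivity)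
  have hY2 : 2 ≤ ⌊Real.exp t⌋₊ := Nat.le_floor (by exact_mod_cast he)
  have hY2' : (2:ℝ) ≤ ⌊Real.exp t⌋₊ := by exact_mod_cast hY2
  have hYt : Real.log ⌊Real.exp t⌋₊ ≤ t := by
    rw [Real.log_le_iff_le_exp (by linarith)]; exact hfl
  refine ⟨⌊Real.exp t⌋₊, hY2, ?_, hYt, ?_⟩
  · have : Real.exp t ≤ X := by
      rw [← Real.le_log_iff_exp_le (by linarith)]; exact htL
    exact_mod_cast hfl.trans this
  · have hlow : t / 4 ≤ Real.log ⌊Real.exp t⌋₊ := by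
      have h1 : Real.exp t / 2 ≤ ⌊Real.exp t⌋₊ := by
        have := Nat.lt_floor_add_one (Real.exp t)
        linarith
      have h2 := Real.log_le_log (by positivity) h1
      rw [Real.log_div (by positivity) (by norm_num), Real.log_exp] at h2
      have := Real.log_two_lt_d9
      linarith
    rw [div_le_iff₀ (by linarith)]
    have e : L = L^((3:ℝ)/14) * t := by
      rw [ht, ← Real.rpow_add (by linarith)]; norm_num
    calc L = L^((3:ℝ)/14) * t := e
      _ = 4 * L^((3:ℝ)/14) * (t/4) := by ring
      _ ≤ _ := by gcongr

/-- moment bound -/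
lemma moment (d : ℤ) (hd : ¬ IsSquare d) (Cd : ℝ) (hCd : 0 < Cd) : ∃ C : ℝ, 0 < C ∧ ∀ X : ℕ, 3 ≤ X → ∃ G : ℤ → ℝ,
    (∀ Δ, 0 ≤ G Δ) ∧ ∑ Δ ∈ Finset.Icc (-(X:ℤ)) X, G Δ ≤ C * X * (Real.log X)^((3:ℝ)/4) ∧
    ∀ Δ : ℤ, Δ.natAbs ≤ X → ¬ IsSquare Δ → ¬ IsSquare (d * Δ) → ∀ κ : ℝ, 0 ≤ κ →
      (∀ U : ℕ, 0 < U → κ ≤ Cd * ((SU Δ U + 4 * Δ.natAbs / U) * (SU (d*Δ) U + 4 * (d*Δ).natAbs / U))) →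
      κ^((7:ℝ)/4) ≤ G Δ := by
  have hd0 : 0 < d.natAbs := Int.natAbs_pos.2 (by rintro rfl; simp at hd)
  have hd1 : (1:ℝ) ≤ d.natAbs := by exact_mod_cast hd0
  obtain ⟨C1, hC1, hB⟩ := lemmaB (4 * d.natAbs) (by positivity)
  obtain ⟨C2, hC2, hD⟩ := lemmaD
  set K := (Cd * C1^2 * 16)^((7:ℝ)/4) with hK
  have hK0 : 0 < K := by positivity
  refine ⟨K * C2, by positivity, fun X hX => ?_⟩
  obtain ⟨Y, hY2, hYX, hYt, hXY⟩ := exists_Y X hX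
  have hX0 : (3:ℝ) ≤ X := by exact_mod_cast hX
  have hL : 0 < Real.log X := Real.log_pos (by linarith)
  have hlY : 0 < Real.log Y := Real.log_pos (by exact_mod_cast (by omega : 1 < Y))
  set a : ℕ → ℝ := fun p => 7/4 * (1 + chi d p) / p with ha
  refine ⟨fun Δ => K * (Real.log X)^((3:ℝ)/4) * Real.exp (∑ p ∈ Y.primesBelow, a p * chi Δ p), fun Δ => by positivity, ?_, ?_⟩
  · rw [← Finset.mul_sum]
    have := hD a (fun p hp => by
      have h1 := abs_le.1 (chi_abs d p)
      have hp0 : (0:ℝ) < p := by exact_mod_cast hp.pos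
      constructor
      · apply div_nonneg _ hp0.le; linarith [h1.1]
      · apply div_le_div_of_nonneg_right _ hp0.le; linarith [h1.2]) X Y (by omega) hY2 hYt
    calc _ ≤ K * (Real.log X)^((3:ℝ)/4) * (C2 * X) := by gcongr
      _ = _ := by ring
  · intro Δ hΔX hΔ hdΔ κ hκ hU
    have hΔX' : (Δ.natAbs:ℝ) ≤ X := by exact_mod_cast hΔX
    have hXp : 0 < X^2 := by positivity
    have b0 := hU (X^2) hXp
    have b1 := hB Δ X Y hΔ hY2 hYX (by
      calc 4 * (Δ.natAbs:ℝ) ≤ 4 * 1 * X := by linarith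
        _ ≤ _ := by gcongr)
    have b2 := hB (d*Δ) X Y hdΔ hY2 hYX (by
      rw [Int.natAbs_mul]; push_cast
      rw [← mul_assoc]
      gcongr)
    have n1 := SU_nonneg Δ hΔ (X^2) hXp
    have n2 := SU_nonneg (d*Δ) hdΔ (X^2) hXp
    have b3 : κ ≤ (Cd * C1^2 * 16) * ((Real.log X)^((3:ℝ)/14))^2 * Real.exp (∑ p ∈ Y.primesBelow, (chi Δ p / p + chi (d*Δ) p / p)) := by
      calc κ ≤ _ := b0
        _ ≤ Cd * ((C1 * (Real.log X / Real.log Y) * Real.exp (∑ p ∈ Y.primesBelow, chi Δ p / p)) * (C1 * (Real.log X / Real.log Y) * Real.exp (∑ p ∈ Y.primesBelow, chi (d*Δ) p / p))) := by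
          gcongr
        _ ≤ Cd * ((C1 * (4 * (Real.log X)^((3:ℝ)/14)) * Real.exp (∑ p ∈ Y.primesBelow, chi Δ p / p)) * (C1 * (4 * (Real.log X)^((3:ℝ)/14)) * Real.exp (∑ p ∈ Y.primesBelow, chi (d*Δ) p / p))) := by
          gcongr
        _ = _ := by
          rw [Finset.sum_add_distrib, Real.exp_add]; ring
    calc κ^((7:ℝ)/4) ≤ ((Cd * C1^2 * 16) * ((Real.log X)^((3:ℝ)/14))^2 * Real.exp (∑ p ∈ Y.primesBelow, (chi Δ p / p + chi (d*Δ) p / p)))^((7:ℝ)/4) := by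
          exact Real.rpow_le_rpow hκ b3 (by norm_num)
      _ = _ := by
        rw [Real.mul_rpow (by positivity) (by positivity), Real.mul_rpow (by positivity) (by positivity), ← Real.exp_mul]
        have e : (((Real.log X)^((3:ℝ)/14))^2)^((7:ℝ)/4) = (Real.log X)^((3:ℝ)/4) := by
          rw [← Real.rpow_natCast, ← Real.rpow_mul hL.le, ← Real.rpow_mul hL.le]
          norm_num
        rw [e]
        congr 2
        rw [Finset.sum_mul]
        refine Finset.sum_congr rfl fun p hp => ?_
        rw [chi_mul_left, ha]
        ring

lemma dyadic (f : ℤ → ℝ) (hf3 : ∀ Δ, Δ.natAbs < 3 → f Δ = 0) (K : ℝ) (hK : 0 ≤ K)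
    (h : ∀ X : ℕ, 3 ≤ X → ∑ Δ ∈ (Finset.Icc (-(X:ℤ)) X).filter (fun Δ => X/2 < Δ.natAbs), f Δ ≤ K * (X:ℝ)^((1:ℝ)/4) * (Real.log X)^((3:ℝ)/4)) (X : ℕ) :
    ∑ Δ ∈ Finset.Icc (-(X:ℤ)) X, f Δ ≤ 10 * K * (X:ℝ)^((1:ℝ)/4) * (Real.log X)^((3:ℝ)/4) := by
  induction X using Nat.strong_induction_on with
  | _ X ih =>
  rcases lt_or_ge X 3 with hX | hX
  · rw [Finset.sum_eq_zero]
    · have := Real.log_natCast_nonneg X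
      positivity
    · intro Δ hΔ
      rw [Finset.mem_Icc] at hΔ
      exact hf3 Δ (by omega)
  · have h1 := ih (X/2) (by omega)
    have h2 := h X hX
    rw [← Finset.sum_filter_add_sum_filter_not _ (fun Δ : ℤ => X/2 < Δ.natAbs)]
    have h3 : (Finset.Icc (-(X:ℤ)) X).filter (fun Δ => ¬ X/2 < Δ.natAbs) = Finset.Icc (-((X/2:ℕ):ℤ)) ((X/2:ℕ):ℤ) := by
      ext Δ
      simp only [Finset.mem_filter, Finset.mem_Icc]
      omega
    rw [h3]
    have hx : ((X/2:ℕ):ℝ) ≤ (X:ℝ)/2 := Nat.cast_div_le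
    have hx1 : (1:ℝ) ≤ ((X/2:ℕ):ℝ) := by exact_mod_cast (by omega : 1 ≤ X/2)
    have hl0 := Real.log_natCast_nonneg (X/2)
    have hl0' := Real.log_natCast_nonneg X
    have hl : Real.log ((X/2:ℕ):ℝ) ≤ Real.log X := Real.log_le_log (by linarith) (by linarith)
    have hq : ((1:ℝ)/2)^((1:ℝ)/4) ≤ 9/10 := by
      have : (9/10:ℝ) = ((9/10:ℝ)^(4:ℕ))^((1:ℝ)/4) := by
        rw [← Real.rpow_natCast, ← Real.rpow_mul (by norm_num)]; norm_num
      rw [this]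
      exact Real.rpow_le_rpow (by norm_num) (by norm_num) (by norm_num)
    have h4 : ((X/2:ℕ):ℝ)^((1:ℝ)/4) ≤ 9/10 * (X:ℝ)^((1:ℝ)/4) := by
      calc ((X/2:ℕ):ℝ)^((1:ℝ)/4) ≤ (1/2 * (X:ℝ))^((1:ℝ)/4) := Real.rpow_le_rpow (by linarith) (by linarith) (by norm_num)
        _ = ((1:ℝ)/2)^((1:ℝ)/4) * (X:ℝ)^((1:ℝ)/4) := Real.mul_rpow (by norm_num) (by positivity)
        _ ≤ _ := by gcongr
    have h5 : 10 * K * ((X/2:ℕ):ℝ)^((1:ℝ)/4) * (Real.log ((X/2:ℕ):ℝ))^((3:ℝ)/4) ≤ 10 * K * (9/10 * (X:ℝ)^((1:ℝ)/4)) * (Real.log X)^((3:ℝ)/4) := by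
      gcongr
    linarith

lemma kpow (κ : ℝ) (h : 0 ≤ κ) : κ^((3:ℝ)/4) * (1 + κ) ≤ 1 + 2 * κ^((7:ℝ)/4) := by
  have e : κ^((7:ℝ)/4) = κ^((3:ℝ)/4) * κ := by
    rcases h.eq_or_lt with rfl | h
    · rw [Real.zero_rpow (by norm_num)]; simp
    · nth_rewrite 3 [← Real.rpow_one κ]
      rw [← Real.rpow_add h]; norm_num
  have h0 : 0 ≤ κ^((3:ℝ)/4) := by positivity
  rcases le_total κ 1 with h1 | h1
  · have : κ^((3:ℝ)/4) ≤ 1 := Real.rpow_le_one h h1 (by norm_num)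
    nlinarith [mul_nonneg h0 h]
  · nlinarith

lemma term_le (d Δ : ℤ) (hΔ : Δ ≠ 0) (H κ : ℝ) (hH : 0 ≤ H) (hκ : 0 ≤ κ) (h : H ≤ 1920 * |(d:ℝ)| * |(Δ:ℝ)| * κ) :
    H^((3:ℝ)/4) * (1 + κ) / |(Δ:ℝ)|^((3:ℝ)/2) ≤ (1920 * |(d:ℝ)|)^((3:ℝ)/4) * (1 + 2 * κ^((7:ℝ)/4)) * |(Δ:ℝ)|^(-(3:ℝ)/4) := by
  have hp : 0 < |(Δ:ℝ)| := abs_pos.2 (by exact_mod_cast hΔ)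
  rw [div_le_iff₀ (by positivity), mul_assoc, mul_assoc, ← Real.rpow_add hp]
  have h1 : H^((3:ℝ)/4) ≤ (1920 * |(d:ℝ)|)^((3:ℝ)/4) * |(Δ:ℝ)|^((3:ℝ)/4) * κ^((3:ℝ)/4) := by
    rw [← Real.mul_rpow (by positivity) (by positivity), ← Real.mul_rpow (by positivity) (by positivity)]
    exact Real.rpow_le_rpow hH h (by norm_num)
  calc H^((3:ℝ)/4) * (1 + κ) ≤ ((1920 * |(d:ℝ)|)^((3:ℝ)/4) * |(Δ:ℝ)|^((3:ℝ)/4) * κ^((3:ℝ)/4)) * (1 + κ) := by gcongr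
    _ = (1920 * |(d:ℝ)|)^((3:ℝ)/4) * |(Δ:ℝ)|^((3:ℝ)/4) * (κ^((3:ℝ)/4) * (1 + κ)) := by ring
    _ ≤ (1920 * |(d:ℝ)|)^((3:ℝ)/4) * |(Δ:ℝ)|^((3:ℝ)/4) * (1 + 2 * κ^((7:ℝ)/4)) := by gcongr; exact kpow κ hκ
    _ = _ := by
      rw [show -(3:ℝ)/4 + 3/2 = 3/4 by norm_num]; ring

lemma final_sum (d : ℤ) (hd : ¬ IsSquare d) (Cd : ℝ) (hCd : 0 < Cd) (E : ℝ) (hE : 0 ≤ E) : ∃ C : ℝ, 0 < C ∧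
    ∀ (f κ : ℤ → ℝ) (P : ℤ → Prop), (∀ Δ, ¬ P Δ → f Δ = 0) → (∀ Δ, P Δ → 3 ≤ Δ.natAbs ∧ ¬ IsSquare Δ ∧ ¬ IsSquare (d * Δ) ∧ 0 ≤ κ Δ ∧
      (∀ U : ℕ, 0 < U → κ Δ ≤ Cd * ((SU Δ U + 4 * Δ.natAbs / U) * (SU (d*Δ) U + 4 * (d*Δ).natAbs / U))) ∧
      f Δ ≤ E * (1 + 2 * (κ Δ)^((7:ℝ)/4)) * |(Δ:ℝ)|^(-(3:ℝ)/4)) → ∀ X : ℕ,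
      ∑ Δ ∈ Finset.Icc (-(X:ℤ)) X, f Δ ≤ C * (X:ℝ)^((1:ℝ)/4) * (Real.log X)^((3:ℝ)/4) := by
  obtain ⟨C, hC, hm⟩ := moment d hd Cd hCd
  refine ⟨10 * (E * 2 * (3 + 2 * C) + 1), by positivity, fun f κ P hf0 hf X => ?_⟩
  refine dyadic f ?_ _ (by positivity) ?_ X
  · intro Δ hΔ
    apply hf0
    intro hP
    have := (hf Δ hP).1
    omega
  clear X
  intro X hX
  have hX0 : (3:ℝ) ≤ X := by exact_mod_cast hX
  have hL : 1 ≤ Real.log X := by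
    rw [Real.le_log_iff_exp_le (by linarith)]
    linarith [Real.exp_one_lt_d9]
  have hL' : 1 ≤ (Real.log X)^((3:ℝ)/4) := Real.one_le_rpow hL (by norm_num)
  obtain ⟨G, hG0, hG, hGb⟩ := hm X hX
  have hpt : ∀ Δ ∈ (Finset.Icc (-(X:ℤ)) X).filter (fun Δ => X/2 < Δ.natAbs), f Δ ≤ E * 2 * (X:ℝ)^(-(3:ℝ)/4) * (1 + 2 * G Δ) := by
    intro Δ hΔ
    rw [Finset.mem_filter, Finset.mem_Icc] at hΔ
    have hG0' := hG0 Δ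
    by_cases hP : P Δ
    · obtain ⟨-, h1, h2, h3, h4, h5⟩ := hf Δ hP
      have h6 := hGb Δ (by omega) h1 h2 _ h3 h4
      have h7 : (X:ℝ)/2 ≤ |(Δ:ℝ)| := by
        have : X ≤ 2 * Δ.natAbs := by omega
        have : (X:ℝ) ≤ 2 * (Δ.natAbs:ℝ) := by exact_mod_cast this
        rw [Nat.cast_natAbs, Int.cast_abs] at this
        linarith
      have h8 : |(Δ:ℝ)|^(-(3:ℝ)/4) ≤ 2 * (X:ℝ)^(-(3:ℝ)/4) := by
        calc |(Δ:ℝ)|^(-(3:ℝ)/4) ≤ ((X:ℝ)/2)^(-(3:ℝ)/4) := Real.rpow_le_rpow_of_nonpos (by linarith) h7 (by norm_num)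
          _ = (X:ℝ)^(-(3:ℝ)/4) * 2^((3:ℝ)/4) := by
            rw [Real.div_rpow (by linarith) (by norm_num), div_eq_mul_inv, ← Real.rpow_neg (by norm_num)]
            norm_num
          _ ≤ (X:ℝ)^(-(3:ℝ)/4) * 2^(1:ℝ) := by
            gcongr <;> norm_num
          _ = _ := by rw [Real.rpow_one]; ring
      calc f Δ ≤ _ := h5
        _ ≤ E * (1 + 2 * G Δ) * (2 * (X:ℝ)^(-(3:ℝ)/4)) := by gcongr
        _ = _ := by ring
    · rw [hf0 Δ hP]; positivity
  refine (Finset.sum_le_sum hpt).trans ?_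
  refine (Finset.sum_le_sum_of_subset_of_nonneg (Finset.filter_subset _ _) fun Δ _ _ => by
    have := hG0 Δ
    positivity).trans ?_
  rw [← Finset.mul_sum, Finset.sum_add_distrib, ← Finset.mul_sum, card_Icc']
  have hx : (X:ℝ)^(-(3:ℝ)/4) * X = (X:ℝ)^((1:ℝ)/4) := by
    nth_rewrite 2 [← Real.rpow_one (X:ℝ)]
    rw [← Real.rpow_add (by linarith)]; norm_num
  have hq : 0 ≤ (X:ℝ)^((1:ℝ)/4) := by positivity
  calc E * 2 * (X:ℝ)^(-(3:ℝ)/4) * ((2 * X + 1) + 2 * ∑ Δ ∈ Finset.Icc (-(X:ℤ)) X, G Δ)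
      ≤ E * 2 * (X:ℝ)^(-(3:ℝ)/4) * ((3 + 2 * C) * X * (Real.log X)^((3:ℝ)/4)) := by
        gcongr
        have : 3 * (X:ℝ) * 1 ≤ 3 * X * (Real.log X)^((3:ℝ)/4) := by gcongr
        linarith
    _ = E * 2 * (3 + 2 * C) * ((X:ℝ)^(-(3:ℝ)/4) * X) * (Real.log X)^((3:ℝ)/4) := by ring
    _ ≤ _ := by
      rw [hx]
      gcongr
      linarith

end

open scoped Classical in
/-- For every fundamental discriminant `Δ` with `Δ ≠ discr ℚ(√d)` let `M Δ` be the biquadratic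
number field `ℚ(√Δ, √d)` (any realization of it). -/
theorem statement_17 (d : ℤ) (hsq : Squarefree d) (hd0 : d ≠ 0) (hd1 : d ≠ 1)
    (γ : ℝ) (hγ : 0 < γ) :
    ∃ C : ℝ, 0 < C ∧
      ∀ (M : ℤ → Type) (instF : ∀ Δ, Field (M Δ)) (instN : ∀ Δ, @NumberField (M Δ) (instF Δ)),
        (∀ Δ, IsFundamentalDiscriminant Δ → Δ ≠ DL d →
          (letI := instF Δ; letI := instN Δ;
            Module.finrank ℚ (M Δ) = 4 ∧ (∃ c : M Δ, c ^ 2 = (d : M Δ)) ∧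
              ∃ s : M Δ, s ^ 2 = (Δ : M Δ))) →
        ∀ B : ℝ, 2 ≤ B →
          (∑ Δ ∈ Finset.Icc ⌈-(B ^ γ)⌉ ⌊B ^ γ⌋,
            if IsFundamentalDiscriminant Δ ∧ Δ ≠ DL d then
              (letI := instF Δ; letI := instN Δ;
                ((classNumber (M Δ) : ℝ) * Units.regulator (M Δ)) ^ ((3 : ℝ) / 4) *
                  (1 + kappa (M Δ)) / |(Δ : ℝ)| ^ ((3 : ℝ) / 2))
            else 0)
          ≤ C * B ^ (γ / 4) * Real.log B ^ ((3 : ℝ) / 4) := by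
  obtain ⟨C, hC, hfin⟩ := final_sum d (sqf_not_square hsq hd1)
    (54 ^ ((2 * d.natAbs).primeFactors.card) * (1 + 4 * d.natAbs)) (by positivity)
    ((1920 * |(d:ℝ)|)^((3:ℝ)/4)) (by positivity)
  refine ⟨C * γ^((3:ℝ)/4), by positivity, fun M instF instN hM B hB => ?_⟩
  have hBγ : 0 ≤ B^γ := by positivity
  have e1 : ⌊B^γ⌋ = ((⌊B^γ⌋₊ : ℕ) : ℤ) := (Int.natCast_floor_eq_floor hBγ).symm
  rw [Int.ceil_neg, e1]
  refine (hfin _ (fun Δ => letI := instF Δ; letI := instN Δ; kappa (M Δ))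
    (fun Δ => IsFundamentalDiscriminant Δ ∧ Δ ≠ DL d) ?_ ?_ ⌊B^γ⌋₊).trans ?_
  · intro Δ hΔ
    exact if_neg hΔ
  · intro Δ hΔ
    letI := instF Δ
    letI := instN Δ
    obtain ⟨h4, hc, hs⟩ := hM Δ hΔ.1 hΔ.2
    obtain ⟨f1, f2, f3, f4⟩ := fund_facts hsq hΔ.1 hΔ.2
    obtain ⟨b1, b2, b3, b4⟩ := field_bound hsq hd1 hΔ.1 hΔ.2 h4 hc hs
    refine ⟨f4, f1, f2, b2, b4, ?_⟩
    rw [if_pos hΔ]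
    exact term_le d Δ (by rintro rfl; simp at f4) _ _ b3 b2 b1
  · have hfl : ((⌊B^γ⌋₊ : ℕ):ℝ) ≤ B^γ := Nat.floor_le hBγ
    have hlB : 0 < Real.log B := Real.log_pos (by linarith)
    have h1 : ((⌊B^γ⌋₊ : ℕ):ℝ)^((1:ℝ)/4) ≤ B^(γ/4) := by
      calc _ ≤ (B^γ)^((1:ℝ)/4) := Real.rpow_le_rpow (by positivity) hfl (by norm_num)
        _ = _ := by rw [← Real.rpow_mul (by linarith)]; ring_nf
    have h2 : Real.log (⌊B^γ⌋₊ : ℕ) ≤ γ * Real.log B := by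
      rcases Nat.eq_zero_or_pos ⌊B^γ⌋₊ with h | h
      · rw [h]; simp; positivity
      · rw [← Real.log_rpow (by linarith)]
        exact Real.log_le_log (by exact_mod_cast h) hfl
    have h0 := Real.log_natCast_nonneg ⌊B^γ⌋₊
    calc _ ≤ C * B^(γ/4) * (γ * Real.log B)^((3:ℝ)/4) := by gcongr
      _ = _ := by rw [Real.mul_rpow hγ.le hlB.le]; ring
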